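/- arXiv:1209.3451 — 2 statements merged into one kernel-verified Lean document; each statement's English description precedes it below -/
import Mathlib

section
/- For every integer N ≥ 1 and every real x, |C(x) − C_N(x)| ≤ 2 c_N · e^{-πN}/√(2N + 1) and |S(x) − S_N(x)| ≤ 2 c_N · e^{-πN}/√(2N + 1). -/
noncomputable section

/-- Fresnel cosine integral `C(x) = ∫_0^x cos(πt²/2) dt`. -/
def C (x : ℝ) : ℝ := ∫ t in (0 : ℝ)..x, Real.cos (Real.pi * t ^ 2 / 2)

/-- Fresnel sine integral `S(x) = ∫_0^x sin(πt²/2) dt`. -/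
def S (x : ℝ) : ℝ := ∫ t in (0 : ℝ)..x, Real.sin (Real.pi * t ^ 2 / 2)

/-- `A_N = √((N + 1/2)π)`. -/
def A (N : ℕ) : ℝ := Real.sqrt (((N : ℝ) + 1 / 2) * Real.pi)

/-- `t_k = (k − 1/2)π/√((N + 1/2)π)`. -/
def tk (N k : ℕ) : ℝ := (((k : ℝ) - 1 / 2) * Real.pi) / Real.sqrt (((N : ℝ) + 1 / 2) * Real.pi)

/-- `a_N(s) = s·Σ_{k=1}^N e^{-t_k²}/(s² + t_k⁴)`. -/
def aN (N : ℕ) (s : ℝ) : ℝ :=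
  s * ∑ k ∈ Finset.Icc 1 N, Real.exp (-(tk N k) ^ 2) / (s ^ 2 + (tk N k) ^ 4)

/-- `b_N(s) = Σ_{k=1}^N t_k²·e^{-t_k²}/(s² + t_k⁴)`. -/
def bN (N : ℕ) (s : ℝ) : ℝ :=
  ∑ k ∈ Finset.Icc 1 N, (tk N k) ^ 2 * Real.exp (-(tk N k) ^ 2) / (s ^ 2 + (tk N k) ^ 4)

/-- The approximation `C_N(x)` to the Fresnel cosine integral. -/
def CN (N : ℕ) (x : ℝ) : ℝ :=
  1 / 2 * ((Real.sinh (Real.sqrt Real.pi * A N * x) + Real.sin (Real.sqrt Real.pi * A N * x)) /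
      (Real.cos (Real.sqrt Real.pi * A N * x) + Real.cosh (Real.sqrt Real.pi * A N * x))) +
    Real.sqrt Real.pi * x / A N *
      (aN N (Real.pi / 2 * x ^ 2) * Real.sin (Real.pi / 2 * x ^ 2) -
        bN N (Real.pi / 2 * x ^ 2) * Real.cos (Real.pi / 2 * x ^ 2))

/-- The approximation `S_N(x)` to the Fresnel sine integral. -/
def SN (N : ℕ) (x : ℝ) : ℝ :=
  1 / 2 * ((Real.sinh (Real.sqrt Real.pi * A N * x) - Real.sin (Real.sqrt Real.pi * A N * x)) /
      (Real.cos (Real.sqrt Real.pi * A N * x) + Real.cosh (Real.sqrt Real.pi * A N * x))) -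
    Real.sqrt Real.pi * x / A N *
      (aN N (Real.pi / 2 * x ^ 2) * Real.cos (Real.pi / 2 * x ^ 2) +
        bN N (Real.pi / 2 * x ^ 2) * Real.sin (Real.pi / 2 * x ^ 2))

/-- `β = 1 − √2/2 − (2√2 + 1)/16`. -/
def β : ℝ := 1 - Real.sqrt 2 / 2 - (2 * Real.sqrt 2 + 1) / 16

/-- The constant `c_N`. -/
def c (N : ℕ) : ℝ :=
  20 * Real.sqrt 2 * Real.exp (-Real.pi / 2) /
      (9 * Real.pi * (1 - Real.exp (-2 * A N ^ 2))) *
      (1 + 2 * Real.sqrt Real.pi * Real.exp (-β * A N ^ 2)) +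
    (2 * Real.pi + 1) * Real.exp (-Real.pi / 2) /
      (2 * Real.sqrt 2 * (Real.pi * Real.sqrt Real.pi) * A N)

theorem tsum_one_div_half_sq_sub_sq {z : ℂ} (hz : 2 * z ∈ Complex.integerComplement) :
    z * ∑' k : ℕ, 1 / (((k : ℂ) + 1 / 2) ^ 2 - z ^ 2) = Real.pi / 2 * Complex.tan (Real.pi * z) := by
  have hz1 : z ∈ Complex.integerComplement := by
    rintro ⟨n, rfl⟩
    exact hz ⟨2 * n, by push_cast; ring⟩
  have hne : ∀ n : ℤ, 2 * z ≠ n := fun n h ↦ hz ⟨n, h.symm⟩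
  have hsum : Summable fun n : ℕ ↦ 1 / (2 * z - (n + 1)) + 1 / (2 * z + (n + 1)) :=
    summable_cotTerm hz
  have hev : ∀ k : ℕ, 1 / (2 * z - ((2 * k : ℕ) + 1)) + 1 / (2 * z + ((2 * k : ℕ) + 1)) =
      -z * (1 / (((k : ℂ) + 1 / 2) ^ 2 - z ^ 2)) := by
    intro k
    have h1 : 2 * z - (2 * k + 1) ≠ 0 := fun h ↦ hne (2 * k + 1) (by
      push_cast; linear_combination h)
    have h2 : 2 * z + (2 * k + 1) ≠ 0 := fun h ↦ hne (-(2 * k + 1)) (by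
      push_cast; linear_combination h)
    have h3 : ((k : ℂ) + 1 / 2) ^ 2 - z ^ 2 =
      -(2 * z - (2 * k + 1)) * (2 * z + (2 * k + 1)) / 4 := by ring
    rw [h3]
    push_cast
    field_simp
    ring
  have hod : ∀ k : ℕ, 1 / (2 * z - ((2 * k + 1 : ℕ) + 1)) + 1 / (2 * z + ((2 * k + 1 : ℕ) + 1)) =
      1 / 2 * (1 / (z - (k + 1)) + 1 / (z + (k + 1))) := by
    intro k
    have e1 : 2 * z - ((2 * k + 1 : ℕ) + 1) = 2 * (z - (k + 1)) := by push_cast; ring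
    have e2 : 2 * z + ((2 * k + 1 : ℕ) + 1) = 2 * (z + (k + 1)) := by push_cast; ring
    rw [e1, e2, one_div_mul_eq_div, ← one_div_mul_one_div, ← one_div_mul_one_div]
    ring
  have hse : Summable fun k : ℕ ↦ 1 / (2 * z - ((2 * k : ℕ) + 1)) + 1 / (2 * z + ((2 * k : ℕ) + 1)) :=
    hsum.comp_injective (i := fun k : ℕ ↦ 2 * k) (mul_right_injective₀ (two_ne_zero' ℕ))
  have hso : Summable fun k : ℕ ↦
      1 / (2 * z - ((2 * k + 1 : ℕ) + 1)) + 1 / (2 * z + ((2 * k + 1 : ℕ) + 1)) :=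
    hsum.comp_injective (i := fun k : ℕ ↦ 2 * k + 1)
      ((add_left_injective 1).comp (mul_right_injective₀ (two_ne_zero' ℕ)))
  have hs := tsum_even_add_odd
    (f := fun n : ℕ ↦ 1 / (2 * z - (n + 1)) + 1 / (2 * z + (n + 1))) hse hso
  simp only [hev, hod] at hs
  rw [tsum_mul_left, tsum_mul_left, ← cot_series_rep' hz, ← cot_series_rep' hz1] at hs
  have hs1 : Complex.sin (Real.pi * z) ≠ 0 := by
    intro h
    obtain ⟨n, hn⟩ := Complex.sin_eq_zero_iff.mp h
    apply hz1
    refine ⟨n, ?_⟩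
    have : (Real.pi : ℂ) ≠ 0 := by exact_mod_cast Real.pi_ne_zero
    apply mul_left_cancel₀ this
    linear_combination -hn
  have hs2 : Complex.cos (Real.pi * z) ≠ 0 := by
    intro h
    obtain ⟨n, hn⟩ := Complex.cos_eq_zero_iff.mp h
    apply hne (2 * n + 1)
    have : (Real.pi : ℂ) ≠ 0 := by exact_mod_cast Real.pi_ne_zero
    apply mul_left_cancel₀ this
    push_cast
    linear_combination 2 * hn
  have hcot : Complex.cot (Real.pi * (2 * z)) =
      (Complex.cot (Real.pi * z) - Complex.tan (Real.pi * z)) / 2 := by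
    rw [show (Real.pi : ℂ) * (2 * z) = 2 * (Real.pi * z) by ring, Complex.cot, Complex.cot,
      Complex.tan, Complex.cos_two_mul', Complex.sin_two_mul]
    field_simp
  rw [hcot] at hs
  have hz0 : z ≠ 0 := fun h ↦ hne 0 (by simp [h])
  have h2 : 1 / (2 * z) = 1 / 2 * (1 / z) := by field_simp
  rw [h2] at hs
  linear_combination -hs

theorem summable_exp_neg_sq_half {q : ℝ} (hq : 0 < q) :
    Summable fun k : ℕ ↦ Real.exp (-(((k : ℝ) + 1 / 2) * q) ^ 2) := by
  refine Summable.of_nonneg_of_le (fun _ ↦ (Real.exp_pos _).le) (fun k ↦ ?_)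
    (Real.summable_exp_nat_mul_of_ge (c := -q ^ 2) (by nlinarith [sq_pos_of_pos hq])
      (f := fun k : ℕ ↦ (k : ℝ)) (fun _ ↦ le_rfl))
  apply Real.exp_le_exp.mpr
  have hk : (k : ℝ) ≤ (k : ℝ) ^ 2 := by exact_mod_cast Nat.le_self_pow two_ne_zero k
  have hk0 : (0 : ℝ) ≤ k := k.cast_nonneg
  nlinarith [mul_nonneg (sq_nonneg q) (show (0 : ℝ) ≤ ((k : ℝ) + 1 / 2) ^ 2 - k by nlinarith)]

theorem summable_exp_neg_sq_succ {q : ℝ} (hq : 0 < q) :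
    Summable fun n : ℕ ↦ Real.exp (-(((n : ℝ) + 1) * q) ^ 2) := by
  refine Summable.of_nonneg_of_le (fun _ ↦ (Real.exp_pos _).le) (fun k ↦ ?_)
    (summable_exp_neg_sq_half hq)
  apply Real.exp_le_exp.mpr
  have : ((k : ℝ) + 1 / 2) * q ≤ ((k : ℝ) + 1) * q := by gcongr; norm_num
  have h0 : 0 ≤ ((k : ℝ) + 1 / 2) * q := by positivity
  nlinarith

theorem theta_alternating {q : ℝ} (hq : 0 < q) :
    1 + 2 * ∑' n : ℕ, (-1) ^ (n + 1) * Real.exp (-(((n : ℝ) + 1) * q) ^ 2) =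
      2 * Real.sqrt Real.pi / q *
        ∑' k : ℕ, Real.exp (-(((k : ℝ) + 1 / 2) * (Real.pi / q)) ^ 2) := by
  have hpi := Real.pi_pos
  have hpi' : (Real.pi : ℂ) ≠ 0 := by exact_mod_cast hpi.ne'
  have hq' : (q : ℂ) ≠ 0 := by exact_mod_cast hq.ne'
  have key := Complex.tsum_exp_neg_quadratic (a := ((q ^ 2 / Real.pi : ℝ) : ℂ))
    (by rw [Complex.ofReal_re]; positivity) (-Complex.I / 2)
  have hroot : (((q ^ 2 / Real.pi : ℝ) : ℂ) ^ (1 / 2 : ℂ)) = ((q / Real.sqrt Real.pi : ℝ) : ℂ) := by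
    have : ((1 / 2 : ℂ)) = ((1 / 2 : ℝ) : ℂ) := by push_cast; rfl
    rw [this, ← Complex.ofReal_cpow (by positivity), ← Real.sqrt_eq_rpow,
      Real.sqrt_div (by positivity), Real.sqrt_sq hq.le]
  have hL : ∀ n : ℤ, Complex.exp (-Real.pi * ((q ^ 2 / Real.pi : ℝ) : ℂ) * n ^ 2 +
      2 * Real.pi * (-Complex.I / 2) * n) = (((-1) ^ n * Real.exp (-(n * q) ^ 2) : ℝ) : ℂ) := by
    intro n
    rw [Complex.exp_add]
    have h1 : Complex.exp (2 * Real.pi * (-Complex.I / 2) * n) = (-1) ^ n := by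
      rw [show 2 * (Real.pi : ℂ) * (-Complex.I / 2) * n = n * (-(Real.pi * Complex.I)) by ring,
        Complex.exp_int_mul, Complex.exp_neg, Complex.exp_pi_mul_I]
      norm_num
    rw [h1]
    push_cast
    rw [mul_comm]
    congr 2
    field_simp
  have hR : ∀ n : ℤ, Complex.exp (-Real.pi / ((q ^ 2 / Real.pi : ℝ) : ℂ) *
      (n + Complex.I * (-Complex.I / 2)) ^ 2) =
      ((Real.exp (-((n + 1 / 2) * (Real.pi / q)) ^ 2) : ℝ) : ℂ) := by
    intro n
    have : Complex.I * (-Complex.I / 2) = 1 / 2 := by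
      linear_combination (-1 / 2 : ℂ) * Complex.I_mul_I
    rw [this]
    push_cast
    congr 1
    field_simp
  simp only [hL, hR, hroot] at key
  rw [← Complex.ofReal_tsum, ← Complex.ofReal_tsum, ← Complex.ofReal_one, ← Complex.ofReal_div,
    ← Complex.ofReal_mul, Complex.ofReal_inj] at key
  have hs1 : Summable fun n : ℕ ↦ (-1 : ℝ) ^ (n + 1) * Real.exp (-(((n : ℝ) + 1) * q) ^ 2) := by
    apply Summable.of_norm
    simpa using summable_exp_neg_sq_succ hq
  have hs2 := summable_exp_neg_sq_half (q := Real.pi / q) (by positivity)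
  have hs1' := hs1.hasSum
  have hs2' := hs2.hasSum
  rw [(HasSum.of_add_one_of_neg_add_one (f := fun n : ℤ ↦ (-1 : ℝ) ^ n * Real.exp (-(n * q) ^ 2))
    (m := ∑' n : ℕ, (-1 : ℝ) ^ (n + 1) * Real.exp (-(((n : ℝ) + 1) * q) ^ 2))
    (m' := ∑' n : ℕ, (-1 : ℝ) ^ (n + 1) * Real.exp (-(((n : ℝ) + 1) * q) ^ 2)) ?_ ?_).tsum_eq,
    (HasSum.of_nat_of_neg_add_one
      (f := fun n : ℤ ↦ Real.exp (-(((n : ℝ) + 1 / 2) * (Real.pi / q)) ^ 2))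
      (m := ∑' k : ℕ, Real.exp (-(((k : ℝ) + 1 / 2) * (Real.pi / q)) ^ 2))
      (m' := ∑' k : ℕ, Real.exp (-(((k : ℝ) + 1 / 2) * (Real.pi / q)) ^ 2)) ?_ ?_).tsum_eq] at key
  · simp only [zpow_zero, Int.cast_zero, zero_mul, one_mul, ne_eq, OfNat.ofNat_ne_zero,
      not_false_eq_true, zero_pow, neg_zero, Real.exp_zero, one_div_div] at key
    linear_combination key
  · simpa using hs2'
  · convert! hs2' using 3
    push_cast
    ring
  · convert! hs1' using 3
    · norm_cast
  · convert! hs1' using 3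
    · rw [zpow_neg]; norm_cast; simp [← inv_pow]
    push_cast; ring_nf

theorem norm_integral_exp_neg_div_sq_mul_cexp_le {a : ℝ} (ha : 0 < a) (θ : ℝ) :
    ‖∫ v in (0 : ℝ)..1, ((Real.exp (-(a / v ^ 2)) : ℝ) : ℂ) * Complex.exp (θ * v ^ 2 * Complex.I)‖ ≤
      Real.exp (-a) / (2 * a) := by
  have hint : ∫ v in (0 : ℝ)..1, Real.exp (-a) * Real.exp (-(2 * a * (1 - v))) =
      Real.exp (-a) * (1 / (2 * a)) - Real.exp (-a) * (Real.exp (-(2 * a)) / (2 * a)) := by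
    rw [intervalIntegral.integral_eq_sub_of_hasDerivAt
      (f := fun v ↦ Real.exp (-a) * (Real.exp (-(2 * a * (1 - v))) / (2 * a)))]
    · simp
    · intro v _
      have h := (((((hasDerivAt_id v).const_sub 1).const_mul (2 * a)).neg.exp).div_const
        (2 * a)).const_mul (Real.exp (-a))
      convert! h using 1
      simp
      field_simp
    · exact Continuous.intervalIntegrable (by fun_prop) _ _
  refine (intervalIntegral.norm_integral_le_of_norm_le
    (g := fun v ↦ Real.exp (-a) * Real.exp (-(2 * a * (1 - v)))) zero_le_one
    (Filter.Eventually.of_forall fun v hv ↦ ?_)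
    (Continuous.intervalIntegrable (by fun_prop) _ _)).trans ?_
  · rw [norm_mul, Complex.norm_real, show (θ : ℂ) * v ^ 2 = ((θ * v ^ 2 : ℝ) : ℂ) by push_cast; rfl,
      Complex.norm_exp_ofReal_mul_I, mul_one, Real.norm_of_nonneg (Real.exp_pos _).le,
      ← Real.exp_add]
    apply Real.exp_le_exp.mpr
    have hv0 : 0 < v := hv.1
    have h : (3 - 2 * v) ≤ 1 / v ^ 2 := by
      rw [le_div_iff₀ (by positivity)]
      nlinarith [mul_nonneg (sq_nonneg (1 - v)) (show 0 ≤ 1 + 2 * v by linarith)]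
    have h2 := mul_le_mul_of_nonneg_left h ha.le
    rw [mul_one_div] at h2
    linarith
  · rw [hint]
    have : 0 ≤ Real.exp (-a) * (Real.exp (-(2 * a)) / (2 * a)) := by positivity
    rw [mul_one_div] at *
    linarith

theorem norm_integral_exp_neg_div_sq_mul_cexp_le_div {a θ : ℝ} (ha : 1 / 2 ≤ a) (hθ : 0 < θ) :
    ‖∫ v in (0 : ℝ)..1, ((Real.exp (-(a / v ^ 2)) : ℝ) : ℂ) * Complex.exp (θ * v ^ 2 * Complex.I)‖ ≤
      Real.exp (-a) / θ := by
  have ha0 : 0 < a := by linarith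
  have hθ' : (θ : ℂ) ≠ 0 := by exact_mod_cast hθ.ne'
  set u : ℝ → ℝ := fun v ↦ Real.exp (-(a / v ^ 2)) / v with hu
  set u' : ℝ → ℝ := fun v ↦ Real.exp (-(a / v ^ 2)) * (2 * a / v ^ 4 - 1 / v ^ 2) with hu'
  set w : ℝ → ℂ := fun v ↦ Complex.exp (θ * v ^ 2 * Complex.I) / (2 * θ * Complex.I) with hw
  set w' : ℝ → ℂ := fun v ↦ v * Complex.exp (θ * v ^ 2 * Complex.I) with hw'
  have hud : ∀ v, 0 < v → HasDerivAt u (u' v) v := by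
    intro v hv
    have h := ((((hasDerivAt_pow 2 v).inv (by positivity)).const_mul a).neg.exp).div
      (hasDerivAt_id v) hv.ne'
    convert! h using 1
    simp [hu']
    field_simp
  have hwd : ∀ v, HasDerivAt w (w' v) v := by
    intro v
    have h := (((((hasDerivAt_id (v : ℂ)).pow 2).const_mul (θ : ℂ)).mul_const
      Complex.I).cexp.div_const (2 * θ * Complex.I)).comp_ofReal
    convert! h using 1
    simp [hw']
    field_simp
  have hu0 : u 0 = 0 := by simp [hu]
  have hub : ∀ v, 0 ≤ v → 0 ≤ u v ∧ u v ≤ v / a := by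
    intro v hv
    rcases hv.eq_or_lt with rfl | hv
    · simp [hu0]
    refine ⟨by positivity, ?_⟩
    have hp : 0 < a / v ^ 2 := by positivity
    have h1 : Real.exp (-(a / v ^ 2)) ≤ (a / v ^ 2)⁻¹ := by
      rw [Real.exp_neg]
      exact inv_anti₀ hp (by linarith [Real.add_one_le_exp (a / v ^ 2)])
    calc u v ≤ (a / v ^ 2)⁻¹ / v := by simp only [hu]; gcongr
      _ = v / a := by field_simp
  have huc : ContinuousOn u (Set.uIcc 0 1) := by
    rw [Set.uIcc_of_le zero_le_one]
    intro v hv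
    rcases hv.1.eq_or_lt with rfl | hv0
    · rw [ContinuousWithinAt, hu0]
      refine tendsto_of_tendsto_of_tendsto_of_le_of_le' tendsto_const_nhds
        (h := fun v ↦ v / a) ?_ ?_ ?_
      · have : Continuous fun v : ℝ ↦ v / a := by fun_prop
        simpa using (this.tendsto 0).mono_left nhdsWithin_le_nhds
      · filter_upwards [self_mem_nhdsWithin] with v hv using (hub v hv.1).1
      · filter_upwards [self_mem_nhdsWithin] with v hv using (hub v hv.1).2
    · exact (hud v hv0).continuousAt.continuousWithinAt
  have hpos : ∀ v ∈ Set.Ioo (0 : ℝ) 1, 0 ≤ u' v := by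
    intro v hv
    have hv0 : 0 < v := hv.1
    refine mul_nonneg (Real.exp_pos _).le ?_
    rw [sub_nonneg, div_le_div_iff₀ (by positivity) (by positivity)]
    nlinarith [hv.2, sq_nonneg v, pow_pos hv0 2, pow_pos hv0 4,
      mul_nonneg (pow_pos hv0 2).le (show 0 ≤ 1 - v ^ 2 by nlinarith [hv.2]),
      mul_nonneg (pow_pos hv0 2).le (show 0 ≤ 2 * a - 1 by linarith)]
  have hud' : ∀ v ∈ Set.Ioo (min (0 : ℝ) 1) (max 0 1), HasDerivAt u (u' v) v := by
    intro v hv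
    rw [min_eq_left zero_le_one] at hv
    exact hud v hv.1
  have hu'i : IntervalIntegrable u' MeasureTheory.volume 0 1 :=
    intervalIntegral.intervalIntegrable_deriv_of_nonneg huc hud' (by simpa using hpos)
  have hint : ∫ v in (0 : ℝ)..1, u' v = Real.exp (-a) := by
    rw [intervalIntegral.integral_eq_sub_of_hasDerivAt_of_le zero_le_one
      (by simpa using huc) (fun v hv ↦ hud v hv.1) hu'i, hu0]
    simp [hu]
  have hwn : ∀ v, ‖w v‖ = 1 / (2 * θ) := by
    intro v
    simp only [hw]
    rw [norm_div, show (θ : ℂ) * v ^ 2 = ((θ * v ^ 2 : ℝ) : ℂ) by push_cast; rfl,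
      Complex.norm_exp_ofReal_mul_I]
    simp [abs_of_pos hθ]
  have hcongr : ∫ v in (0 : ℝ)..1, ((Real.exp (-(a / v ^ 2)) : ℝ) : ℂ) *
      Complex.exp (θ * v ^ 2 * Complex.I) = ∫ v in (0 : ℝ)..1, (u v : ℂ) * w' v := by
    refine intervalIntegral.integral_congr_ae (Filter.Eventually.of_forall fun v hv ↦ ?_)
    rw [Set.uIoc_of_le zero_le_one] at hv
    have : (v : ℂ) ≠ 0 := by exact_mod_cast hv.1.ne'
    simp only [hu, hw']
    push_cast
    field_simp
  have hwc : Continuous w := continuous_iff_continuousAt.mpr fun v ↦ (hwd v).continuousAt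
  rw [hcongr, intervalIntegral.integral_mul_deriv_eq_deriv_mul_of_hasDerivAt
    (u := fun v ↦ (u v : ℂ))
    (u' := fun v ↦ (u' v : ℂ)) (v := w) (Complex.continuous_ofReal.comp_continuousOn huc)
    hwc.continuousOn (fun v hv ↦ (hud' v hv).ofReal_comp) (fun v _ ↦ hwd v) ⟨hu'i.1.ofReal, hu'i.2.ofReal⟩
    (Continuous.intervalIntegrable (by fun_prop) _ _), hu0]
  have h1 : ‖∫ v in (0 : ℝ)..1, (u' v : ℂ) * w v‖ ≤ Real.exp (-a) * (1 / (2 * θ)) := by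
    rw [← hint, ← intervalIntegral.integral_mul_const]
    refine intervalIntegral.norm_integral_le_of_norm_le zero_le_one ?_ (hu'i.mul_const _)
    have hne : ∀ᵐ v : ℝ, v ≠ 1 := by simp [MeasureTheory.ae_iff]
    filter_upwards [hne] with v hv1 hv
    rw [norm_mul, hwn, Complex.norm_real,
      Real.norm_of_nonneg (hpos v ⟨hv.1, lt_of_le_of_ne hv.2 hv1⟩)]
  have h2 : ‖(u 1 : ℂ) * w 1‖ = Real.exp (-a) * (1 / (2 * θ)) := by
    rw [norm_mul, hwn, Complex.norm_real, Real.norm_of_nonneg (hub 1 zero_le_one).1]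
    simp [hu]
  calc _ ≤ ‖(u 1 : ℂ) * w 1‖ + ‖∫ v in (0 : ℝ)..1, (u' v : ℂ) * w v‖ := by
        rw [Complex.ofReal_zero, zero_mul, sub_zero]
        exact norm_sub_le _ _
    _ ≤ Real.exp (-a) * (1 / (2 * θ)) + Real.exp (-a) * (1 / (2 * θ)) := by rw [h2]; gcongr
    _ = Real.exp (-a) / θ := by field_simp; ring

theorem summable_one_div_half_mul_sq (h : ℝ) :
    Summable fun k : ℕ ↦ 1 / (((k : ℝ) + 1 / 2) * h) ^ 2 := by
  have h1 : Summable fun k : ℕ ↦ 1 / |(k : ℝ) + 1 / 2| ^ (2 : ℝ) :=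
    Real.summable_one_div_nat_add_rpow (1 / 2) 2 |>.mpr one_lt_two
  refine (h1.mul_right (1 / h ^ 2)).congr fun k ↦ ?_
  rw [Real.rpow_two, sq_abs, mul_pow, one_div_mul_one_div]

theorem integral_two_mul_exp_neg_sq_mul {w : ℝ} (hw : w ≠ 0) :
    ∫ v in (0 : ℝ)..1, 2 * v * Real.exp (-(v ^ 2 * w)) = (1 - Real.exp (-w)) / w := by
  rw [intervalIntegral.integral_eq_sub_of_hasDerivAt
    (f := fun v ↦ -(Real.exp (-(v ^ 2 * w)) / w))]
  · simp
    ring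
  · intro v _
    have h := ((((hasDerivAt_id v).pow 2).mul_const w).neg.exp.div_const w).neg
    convert! h using 1
    simp
    field_simp
  · exact Continuous.intervalIntegrable (by fun_prop) _ _

theorem integral_two_mul_cexp_neg_sq_mul {w : ℂ} (hw : w ≠ 0) :
    ∫ v in (0 : ℝ)..1, 2 * (v : ℂ) * Complex.exp (-(v ^ 2 * w)) = (1 - Complex.exp (-w)) / w := by
  rw [intervalIntegral.integral_eq_sub_of_hasDerivAt
    (f := fun v : ℝ ↦ -(Complex.exp (-((v : ℂ) ^ 2 * w)) / w))]
  · simp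
    ring
  · intro v _
    have h := ((((hasDerivAt_id (v : ℂ)).pow 2).mul_const w).neg.cexp.div_const w).neg.comp_ofReal
    convert! h using 1
    simp
    field_simp
  · exact Continuous.intervalIntegrable (by fun_prop) _ _

theorem sq_sub_mul_I_ne_zero {t : ℝ} (ht : 0 < t) (θ : ℝ) : (t : ℂ) ^ 2 - θ * Complex.I ≠ 0 := by
  intro h
  have := congrArg Complex.re h
  rw [← Complex.ofReal_pow] at this
  rw [Complex.sub_re, Complex.re_ofReal_mul, Complex.I_re, mul_zero, sub_zero,
    Complex.ofReal_re, Complex.zero_re] at this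
  exact (pow_pos ht 2).ne' this

theorem hasSum_one_sub_cexp_neg_div {α : ℝ} (hα : 0 < α) (θ : ℝ) :
    HasSum (fun k : ℕ ↦
      (1 - Complex.exp (-((((((k : ℝ) + 1 / 2) * (Real.pi / α) : ℝ) : ℂ)) ^ 2 - θ * Complex.I))) /
        ((((((k : ℝ) + 1 / 2) * (Real.pi / α) : ℝ) : ℂ)) ^ 2 - θ * Complex.I))
    (((α / Real.sqrt Real.pi : ℝ) : ℂ) * ((∫ v in (0 : ℝ)..1, Complex.exp (θ * v ^ 2 * Complex.I)) +
      2 * ∑' n : ℕ, (-1) ^ (n + 1) * ∫ v in (0 : ℝ)..1,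
        ((Real.exp (-((((n : ℝ) + 1) * α) ^ 2 / v ^ 2)) : ℝ) : ℂ) *
          Complex.exp (θ * v ^ 2 * Complex.I))) := by
  have hpi := Real.pi_pos
  set t : ℕ → ℝ := fun k ↦ ((k : ℝ) + 1 / 2) * (Real.pi / α) with ht
  have htpos : ∀ k, 0 < t k := fun k ↦ by simp only [ht]; positivity
  have hF := MeasureTheory.hasSum_integral_of_summable_integral_norm
    (μ := MeasureTheory.volume.restrict (Set.Ioc (0 : ℝ) 1))
    (F := fun (k : ℕ) (v : ℝ) ↦ 2 * (v : ℂ) *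
      Complex.exp (-((v : ℂ) ^ 2 * ((t k : ℂ) ^ 2 - θ * Complex.I)))) ?_ ?_
  rotate_left
  · intro k
    exact (Continuous.integrableOn_Icc (by fun_prop)).mono_set Set.Ioc_subset_Icc_self
  · refine Summable.of_nonneg_of_le (fun k ↦ by positivity) (fun k ↦ ?_)
      (summable_one_div_half_mul_sq (Real.pi / α))
    have : ∫ v in Set.Ioc (0 : ℝ) 1, ‖2 * (v : ℂ) *
        Complex.exp (-((v : ℂ) ^ 2 * ((t k : ℂ) ^ 2 - θ * Complex.I)))‖ =
        ∫ v in Set.Ioc (0 : ℝ) 1, 2 * v * Real.exp (-(v ^ 2 * (t k) ^ 2)) := by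
      refine MeasureTheory.setIntegral_congr_fun measurableSet_Ioc fun v hv ↦ ?_
      have e : -((v : ℂ) ^ 2 * ((t k : ℂ) ^ 2 - θ * Complex.I)) =
        ((-(v ^ 2 * (t k) ^ 2) : ℝ) : ℂ) + ((v ^ 2 * θ : ℝ) : ℂ) * Complex.I := by
        push_cast; ring
      simp only [e]
      rw [Complex.exp_add, norm_mul, norm_mul, norm_mul, Complex.norm_exp_ofReal_mul_I, mul_one,
        ← Complex.ofReal_exp, Complex.norm_real, Complex.norm_real, Complex.norm_ofNat,
        Real.norm_of_nonneg hv.1.le, Real.norm_of_nonneg (Real.exp_pos _).le]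
    rw [this, ← intervalIntegral.integral_of_le zero_le_one,
      integral_two_mul_exp_neg_sq_mul (pow_pos (htpos k) 2).ne']
    have := htpos k
    change _ ≤ 1 / (t k) ^ 2
    gcongr
    linarith [Real.exp_pos (-(t k) ^ 2)]
  have hbound : ∀ (n : ℕ) (v : ℝ), v ∈ Set.Ioc 0 1 → ‖(-1 : ℂ) ^ (n + 1) *
      (((Real.exp (-((((n : ℝ) + 1) * α) ^ 2 / v ^ 2)) : ℝ) : ℂ) *
          Complex.exp (θ * v ^ 2 * Complex.I))‖ ≤ Real.exp (-(((n : ℝ) + 1) * α) ^ 2) := by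
    intro n v hv
    rw [norm_mul, norm_mul, show (θ : ℂ) * v ^ 2 = ((θ * v ^ 2 : ℝ) : ℂ) by
      push_cast; rfl, Complex.norm_exp_ofReal_mul_I, Complex.norm_real,
      Real.norm_of_nonneg (Real.exp_pos _).le]
    simp only [norm_pow, norm_neg, norm_one, one_pow, one_mul, mul_one]
    apply Real.exp_le_exp.mpr
    rw [neg_le_neg_iff]
    exact le_div_self (by positivity) (pow_pos hv.1 2) (pow_le_one₀ hv.1.le hv.2)
  have hG := MeasureTheory.hasSum_integral_of_summable_integral_norm
    (μ := MeasureTheory.volume.restrict (Set.Ioc (0 : ℝ) 1))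
    (F := fun (n : ℕ) (v : ℝ) ↦ (-1 : ℂ) ^ (n + 1) *
      (((Real.exp (-((((n : ℝ) + 1) * α) ^ 2 / v ^ 2)) : ℝ) : ℂ) *
          Complex.exp (θ * v ^ 2 * Complex.I))) ?_ ?_
  rotate_left
  · intro n
    refine MeasureTheory.Integrable.of_bound
      (Measurable.aestronglyMeasurable (by fun_prop)) 1 (Filter.Eventually.of_forall fun v ↦ ?_)
    rw [norm_mul, norm_mul, show (θ : ℂ) * v ^ 2 = ((θ * v ^ 2 : ℝ) : ℂ) by push_cast; rfl,
      Complex.norm_exp_ofReal_mul_I, Complex.norm_real, Real.norm_of_nonneg (Real.exp_pos _).le]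
    simp only [norm_pow, norm_neg, norm_one, one_pow, one_mul, mul_one]
    apply Real.exp_le_one_iff.mpr
    rw [neg_nonpos]
    positivity
  · refine Summable.of_nonneg_of_le (fun k ↦ by positivity) (fun n ↦ ?_)
      (summable_exp_neg_sq_succ hα)
    rw [← intervalIntegral.integral_of_le zero_le_one]
    have hb := intervalIntegral.norm_integral_le_of_norm_le_const (a := 0) (b := 1)
      (f := fun v : ℝ ↦ ‖(-1 : ℂ) ^ (n + 1) *
      (((Real.exp (-((((n : ℝ) + 1) * α) ^ 2 / v ^ 2)) : ℝ) : ℂ) *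
          Complex.exp (θ * v ^ 2 * Complex.I))‖) (C := Real.exp (-(((n : ℝ) + 1) * α) ^ 2)) ?_
    · rw [sub_zero, abs_one, mul_one] at hb
      exact (Real.le_norm_self _).trans hb
    · intro v hv
      rw [Set.uIoc_of_le zero_le_one] at hv
      rw [norm_norm]
      exact hbound n v hv
  simp only [← intervalIntegral.integral_of_le (zero_le_one' ℝ)] at hF hG
  simp only [fun k ↦ integral_two_mul_cexp_neg_sq_mul (sq_sub_mul_I_ne_zero (htpos k) θ)] at hF
  simp only [intervalIntegral.integral_const_mul] at hG
  convert! hF using 1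
  rw [hG.tsum_eq, ← intervalIntegral.integral_const_mul, ← intervalIntegral.integral_add]
  · rw [← intervalIntegral.integral_const_mul]
    refine intervalIntegral.integral_congr_ae (Filter.Eventually.of_forall fun v hv ↦ ?_)
    rw [Set.uIoc_of_le zero_le_one] at hv
    have hv0 : 0 < v := hv.1
    have hθ := theta_alternating (q := α / v) (by positivity)
    have e1 : ∀ n : ℕ, -(((n : ℝ) + 1) * (α / v)) ^ 2 = -((((n : ℝ) + 1) * α) ^ 2 / v ^ 2) := by
      intro n; ring
    have e2 : ∀ k : ℕ, -(((k : ℝ) + 1 / 2) * (Real.pi / (α / v))) ^ 2 = -(v ^ 2 * (t k) ^ 2) := by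
      intro k; simp only [ht]; field_simp
    simp only [e1, e2] at hθ
    have hθ' := congrArg (fun r : ℝ ↦ (r : ℂ)) hθ
    have e3 : ∀ k : ℕ, 2 * (v : ℂ) * Complex.exp (-((v : ℂ) ^ 2 * ((t k : ℂ) ^ 2 - θ * Complex.I))) =
        2 * (v : ℂ) * Complex.exp (θ * v ^ 2 * Complex.I) *
          ((Real.exp (-(v ^ 2 * (t k) ^ 2)) : ℝ) : ℂ) := by
      intro k
      rw [Complex.ofReal_exp, mul_assoc _ (Complex.exp _), ← Complex.exp_add]
      congr 2
      push_cast
      ring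
    have e4 : ∀ n : ℕ, (-1 : ℂ) ^ (n + 1) *
      (((Real.exp (-((((n : ℝ) + 1) * α) ^ 2 / v ^ 2)) : ℝ) : ℂ) *
          Complex.exp (θ * v ^ 2 * Complex.I)) = Complex.exp (θ * v ^ 2 * Complex.I) *
        (((-1) ^ (n + 1) * Real.exp (-((((n : ℝ) + 1) * α) ^ 2 / v ^ 2)) : ℝ) : ℂ) := by
      intro n; push_cast; ring
    simp only [e3, e4]
    rw [tsum_mul_left, tsum_mul_left, ← Complex.ofReal_tsum, ← Complex.ofReal_tsum]
    generalize (∑' n : ℕ, (-1) ^ (n + 1) * Real.exp (-((((n : ℝ) + 1) * α) ^ 2 / v ^ 2)) : ℝ) = X at *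
    generalize (∑' k : ℕ, Real.exp (-(v ^ 2 * (t k) ^ 2)) : ℝ) = Y at *
    push_cast at hθ' ⊢
    have hs : ((Real.sqrt Real.pi : ℝ) : ℂ) ≠ 0 := by
      exact_mod_cast (Real.sqrt_pos.mpr hpi).ne'
    have hα' : (α : ℂ) ≠ 0 := by exact_mod_cast hα.ne'
    have hv' : (v : ℂ) ≠ 0 := by exact_mod_cast hv0.ne'
    field_simp at hθ' ⊢
    linear_combination hθ'
  · exact Continuous.intervalIntegrable (by fun_prop) _ _
  · rw [intervalIntegrable_iff_integrableOn_Ioc_of_le zero_le_one]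
    refine MeasureTheory.Integrable.const_mul (MeasureTheory.Integrable.of_bound
      (Measurable.aestronglyMeasurable (Measurable.tsum fun n ↦ by fun_prop))
      (∑' n : ℕ, Real.exp (-(((n : ℝ) + 1) * α) ^ 2)) ?_) 2
    refine (MeasureTheory.ae_restrict_iff' measurableSet_Ioc).mpr
      (Filter.Eventually.of_forall fun v hv ↦ ?_)
    exact tsum_of_norm_bounded (summable_exp_neg_sq_succ hα).hasSum fun n ↦ hbound n v hv

theorem tan_half_add_half_mul_I {u : ℝ} (hu : u ≠ 0) :
    Complex.tan ((u / 2 : ℝ) + (u / 2 : ℝ) * Complex.I) =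
      ((Real.sin u : ℝ) + (Real.sinh u : ℝ) * Complex.I) / ((Real.cos u + Real.cosh u : ℝ) : ℂ) := by
  have hpos : 0 < Real.cos u + Real.cosh u := by
    linarith [Real.neg_one_le_cos u, Real.one_lt_cosh.mpr hu]
  have hne : ((Real.cos u + Real.cosh u : ℝ) : ℂ) ≠ 0 := by exact_mod_cast hpos.ne'
  obtain ⟨p, rfl⟩ : ∃ p, u = 2 * p := ⟨u / 2, by ring⟩
  rw [show 2 * p / 2 = p by ring]
  set s := Complex.sin (p : ℂ)
  set c := Complex.cos (p : ℂ)
  set sh := Complex.sinh (p : ℂ)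
  set ch := Complex.cosh (p : ℂ)
  have h1 : s ^ 2 + c ^ 2 = 1 := Complex.sin_sq_add_cos_sq _
  have h2 : ch ^ 2 - sh ^ 2 = 1 := Complex.cosh_sq_sub_sinh_sq _
  have hI : Complex.I ^ 2 = -1 := Complex.I_sq
  have hD : ((Real.cos (2 * p) + Real.cosh (2 * p) : ℝ) : ℂ) = 2 * c ^ 2 + 2 * ch ^ 2 - 2 := by
    push_cast
    rw [Complex.cos_two_mul, Complex.cosh_two_mul]
    linear_combination -h2
  have hcos : Complex.cos (p + p * Complex.I) = c * ch - s * sh * Complex.I :=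
    Complex.cos_add_mul_I _ _
  have hsin : Complex.sin (p + p * Complex.I) = s * ch + c * sh * Complex.I :=
    Complex.sin_add_mul_I _ _
  have hc0 : Complex.cos (p + p * Complex.I) ≠ 0 := by
    intro h
    rw [hcos] at h
    apply hne
    rw [hD]
    linear_combination 2 * (c * ch + s * sh * Complex.I) * h - 2 * c ^ 2 * h2 +
      2 * s ^ 2 * sh ^ 2 * hI - (2 * sh ^ 2) * h1 + 2 * h2
  rw [Complex.tan, div_eq_div_iff hc0 hne, hD, hcos, hsin]
  push_cast
  rw [Complex.sin_two_mul, Complex.sinh_two_mul]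
  linear_combination 2 * Complex.I * c * sh * h1 + 2 * s * ch * h2 + 2 * s * sh ^ 2 * ch * hI

theorem sqrt_pi_mul_div_mul_tsum_one_div {α x : ℝ} (hα : 0 < α) (hx : x ≠ 0) :
    ((Real.sqrt Real.pi * x / α : ℝ) : ℂ) * ∑' k : ℕ,
      1 / ((((((k : ℝ) + 1 / 2) * (Real.pi / α) : ℝ) : ℂ)) ^ 2 -
        ((Real.pi / 2 * x ^ 2 : ℝ) : ℂ) * Complex.I) =
    ((1 / 2 * ((Real.sinh (Real.sqrt Real.pi * α * x) + Real.sin (Real.sqrt Real.pi * α * x)) /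
      (Real.cos (Real.sqrt Real.pi * α * x) + Real.cosh (Real.sqrt Real.pi * α * x))) : ℝ) : ℂ) +
    ((1 / 2 * ((Real.sinh (Real.sqrt Real.pi * α * x) - Real.sin (Real.sqrt Real.pi * α * x)) /
      (Real.cos (Real.sqrt Real.pi * α * x) + Real.cosh (Real.sqrt Real.pi * α * x))) : ℝ) : ℂ) *
      Complex.I := by
  have hpi := Real.pi_pos
  have hpi' : (Real.pi : ℂ) ≠ 0 := by exact_mod_cast hpi.ne'
  have hα' : (α : ℂ) ≠ 0 := by exact_mod_cast hα.ne'
  have hs : 0 < Real.sqrt Real.pi := Real.sqrt_pos.mpr hpi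
  have hssq : ((Real.sqrt Real.pi : ℝ) : ℂ) ^ 2 = Real.pi := by
    exact_mod_cast Real.sq_sqrt hpi.le
  set u : ℝ := Real.sqrt Real.pi * α * x with hu
  have hu0 : u ≠ 0 := by positivity
  have hu0' : (u : ℂ) ≠ 0 := by exact_mod_cast hu0
  have huc : (u : ℂ) = (Real.sqrt Real.pi : ℝ) * α * x := by rw [hu]; push_cast; rfl
  have hpos : 0 < Real.cos u + Real.cosh u := by
    linarith [Real.neg_one_le_cos u, Real.one_lt_cosh.mpr hu0]
  have hne : ((Real.cos u + Real.cosh u : ℝ) : ℂ) ≠ 0 := by exact_mod_cast hpos.ne'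
  obtain ⟨z, hz⟩ : ∃ z : ℂ,
    z = ((u / (2 * Real.pi) : ℝ) : ℂ) + ((u / (2 * Real.pi) : ℝ) : ℂ) * Complex.I := ⟨_, rfl⟩
  have hI : Complex.I ^ 2 = -1 := Complex.I_sq
  have hz2 : 2 * z ∈ Complex.integerComplement := by
    rintro ⟨n, hn⟩
    have him : z.im = u / (2 * Real.pi) := by
      rw [hz, Complex.add_im, Complex.ofReal_im, Complex.im_ofReal_mul,
        Complex.I_im, zero_add, mul_one]
    have := congrArg Complex.im hn
    rw [Complex.intCast_im, Complex.mul_im, him, Complex.re_ofNat, Complex.im_ofNat, zero_mul,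
      add_zero] at this
    have h0 : 2 * (u / (2 * Real.pi)) ≠ 0 := by positivity
    exact h0 this.symm
  have htan := tsum_one_div_half_sq_sub_sq hz2
  have hpz : (Real.pi : ℂ) * z = ((u / 2 : ℝ) : ℂ) + ((u / 2 : ℝ) : ℂ) * Complex.I := by
    rw [hz]; push_cast; field_simp
  have hzu : (2 * Real.pi : ℂ) * z = u * (1 + Complex.I) := by
    rw [hz]; push_cast; field_simp
  rw [hpz, tan_half_add_half_mul_I hu0] at htan
  have hterm : ∀ k : ℕ, 1 / ((((((k : ℝ) + 1 / 2) * (Real.pi / α) : ℝ) : ℂ)) ^ 2 -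
        ((Real.pi / 2 * x ^ 2 : ℝ) : ℂ) * Complex.I) =
      (α / Real.pi) ^ 2 * (1 / (((k : ℂ) + 1 / 2) ^ 2 - z ^ 2)) := by
    intro k
    have : (((((k : ℝ) + 1 / 2) * (Real.pi / α) : ℝ) : ℂ)) ^ 2 -
        ((Real.pi / 2 * x ^ 2 : ℝ) : ℂ) * Complex.I =
        (Real.pi / α) ^ 2 * (((k : ℂ) + 1 / 2) ^ 2 - z ^ 2) := by
      have h4 : (2 * Real.pi : ℂ) ^ 2 * z ^ 2 = 2 * Real.pi * α ^ 2 * x ^ 2 * Complex.I := by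
        rw [← mul_pow, hzu, huc]
        linear_combination (α : ℂ) ^ 2 * x ^ 2 * (1 + Complex.I) ^ 2 * hssq +
          Real.pi * α ^ 2 * x ^ 2 * hI
      have h5 : z ^ 2 = α ^ 2 * x ^ 2 * Complex.I / (2 * Real.pi) := by
        field_simp
        apply mul_left_cancel₀ (mul_ne_zero two_ne_zero hpi')
        linear_combination h4
      rw [h5]
      push_cast
      field_simp
    rw [this, ← one_div_mul_one_div, ← one_div_pow, one_div_div]
  simp only [hterm]
  rw [tsum_mul_left]
  generalize (∑' k : ℕ, 1 / (((k : ℂ) + 1 / 2) ^ 2 - z ^ 2)) = T at *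
  have h1I : (1 + Complex.I) ≠ 0 := by
    intro h
    have := congrArg Complex.re h
    simp at this
  have hT : (u : ℂ) * (1 + Complex.I) * T = (2 * Real.pi : ℂ) * (z * T) := by rw [← hzu]; ring
  rw [htan] at hT
  have hgoal : ((Real.sqrt Real.pi * x / α : ℝ) : ℂ) * ((α / Real.pi) ^ 2 * T) =
      (u * T) / Real.pi ^ 2 := by
    rw [huc]; push_cast; field_simp
  rw [hgoal]
  apply mul_left_cancel₀ h1I
  have e : (1 + Complex.I) * (u * T / Real.pi ^ 2) = (u * (1 + Complex.I) * T) / Real.pi ^ 2 := by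
    ring
  rw [e, hT]
  push_cast at hne ⊢
  field_simp
  linear_combination (Complex.sin u - Complex.sinh u) * hI

theorem cexp_neg_div_eq (t θ : ℝ) :
    Complex.exp (-((t : ℂ) ^ 2 - θ * Complex.I)) / ((t : ℂ) ^ 2 - θ * Complex.I) =
      ((t ^ 2 * Real.exp (-t ^ 2) / (θ ^ 2 + t ^ 4) * Real.cos θ -
        θ * (Real.exp (-t ^ 2) / (θ ^ 2 + t ^ 4)) * Real.sin θ : ℝ) : ℂ) +
      ((θ * (Real.exp (-t ^ 2) / (θ ^ 2 + t ^ 4)) * Real.cos θ +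
        t ^ 2 * Real.exp (-t ^ 2) / (θ ^ 2 + t ^ 4) * Real.sin θ : ℝ) : ℂ) * Complex.I := by
  have hI : Complex.I ^ 2 = -1 := Complex.I_sq
  have hinv : ((t : ℂ) ^ 2 - θ * Complex.I)⁻¹ =
      (t ^ 2 + θ * Complex.I) * ((θ : ℂ) ^ 2 + t ^ 4)⁻¹ := by
    apply Complex.ext <;>
    · rw [show (θ : ℂ) ^ 2 + t ^ 4 = ((θ ^ 2 + t ^ 4 : ℝ) : ℂ) by push_cast; rfl,
        ← Complex.ofReal_inv, ← Complex.ofReal_pow]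
      simp [Complex.normSq_apply, -Complex.ofReal_inv, -Complex.ofReal_pow, -Complex.ofReal_add]
      ring_nf
  rw [div_eq_mul_inv, hinv, neg_sub, sub_eq_add_neg, Complex.exp_add, Complex.exp_mul_I]
  push_cast
  ring_nf
  rw [hI]
  ring

theorem cexp_fresnel_integral (x : ℝ) :
    (x : ℂ) * ∫ v in (0 : ℝ)..1, Complex.exp (((Real.pi / 2 * x ^ 2 : ℝ) : ℂ) * v ^ 2 * Complex.I) =
      (C x : ℂ) + (S x : ℂ) * Complex.I := by
  have h := intervalIntegral.smul_integral_comp_mul_left (a := 0) (b := 1)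
    (fun t : ℝ ↦ Complex.exp (((Real.pi * t ^ 2 / 2 : ℝ) : ℂ) * Complex.I)) x
  rw [mul_zero, mul_one, Complex.real_smul] at h
  have e : ∀ v : ℝ, ((Real.pi / 2 * x ^ 2 : ℝ) : ℂ) * v ^ 2 * Complex.I =
      ((Real.pi * (x * v) ^ 2 / 2 : ℝ) : ℂ) * Complex.I := by
    intro v; push_cast; ring
  simp only [e]
  rw [h, C, S, ← intervalIntegral.integral_ofReal, ← intervalIntegral.integral_ofReal,
    ← intervalIntegral.integral_mul_const, ← intervalIntegral.integral_add]
  · simp only [Complex.exp_mul_I, Complex.ofReal_cos, Complex.ofReal_sin]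
  · exact Continuous.intervalIntegrable (by fun_prop) _ _
  · exact Continuous.intervalIntegrable (by fun_prop) _ _

theorem A_pos (N : ℕ) : 0 < A N := by
  have := Real.pi_pos
  rw [A]
  positivity

theorem A_sq (N : ℕ) : A N ^ 2 = ((N : ℝ) + 1 / 2) * Real.pi := by
  have := Real.pi_pos
  rw [A, Real.sq_sqrt (by positivity)]

theorem tk_succ (N k : ℕ) : tk N (k + 1) = ((k : ℝ) + 1 / 2) * (Real.pi / A N) := by
  rw [tk, A]
  push_cast
  ring

theorem sum_Icc_one_eq_sum_range_succ {M : Type*} [AddCommMonoid M] (f : ℕ → M) (N : ℕ) :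
    ∑ k ∈ Finset.Icc 1 N, f k = ∑ k ∈ Finset.range N, f (k + 1) := by
  induction N with
  | zero => simp
  | succ n ih => rw [Finset.sum_Icc_succ_top (by lia), ih, Finset.sum_range_succ]

theorem sqrt_pi_mul_sum_cexp_neg_div (N : ℕ) (x : ℝ) :
    ((Real.sqrt Real.pi * x / A N : ℝ) : ℂ) * ∑ k ∈ Finset.range N,
      Complex.exp (-((((((k : ℝ) + 1 / 2) * (Real.pi / A N) : ℝ) : ℂ)) ^ 2 -
          ((Real.pi / 2 * x ^ 2 : ℝ) : ℂ) * Complex.I)) /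
        ((((((k : ℝ) + 1 / 2) * (Real.pi / A N) : ℝ) : ℂ)) ^ 2 -
          ((Real.pi / 2 * x ^ 2 : ℝ) : ℂ) * Complex.I) =
    -(((Real.sqrt Real.pi * x / A N *
        (aN N (Real.pi / 2 * x ^ 2) * Real.sin (Real.pi / 2 * x ^ 2) -
          bN N (Real.pi / 2 * x ^ 2) * Real.cos (Real.pi / 2 * x ^ 2)) : ℝ) : ℂ) -
      ((Real.sqrt Real.pi * x / A N *
        (aN N (Real.pi / 2 * x ^ 2) * Real.cos (Real.pi / 2 * x ^ 2) +
          bN N (Real.pi / 2 * x ^ 2) * Real.sin (Real.pi / 2 * x ^ 2)) : ℝ) : ℂ) * Complex.I) := by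
  simp only [← tk_succ, cexp_neg_div_eq]
  rw [Finset.sum_add_distrib, ← Finset.sum_mul, ← Complex.ofReal_sum, ← Complex.ofReal_sum,
    Finset.sum_sub_distrib, Finset.sum_add_distrib, ← Finset.sum_mul, ← Finset.sum_mul,
    ← Finset.sum_mul, ← Finset.sum_mul, ← Finset.mul_sum, aN, bN, sum_Icc_one_eq_sum_range_succ,
    sum_Icc_one_eq_sum_range_succ]
  push_cast
  ring

theorem summable_div_sq_sub_mul_I {α : ℝ} (hα : 0 < α) (θ : ℝ) {f : ℕ → ℂ} (hf : ∀ k, ‖f k‖ ≤ 1) :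
    Summable fun k : ℕ ↦
      f k / ((((((k : ℝ) + 1 / 2) * (Real.pi / α) : ℝ) : ℂ)) ^ 2 - θ * Complex.I) := by
  refine Summable.of_norm_bounded (summable_one_div_half_mul_sq (Real.pi / α)) fun k ↦ ?_
  have hpi := Real.pi_pos
  have ht : 0 < ((k : ℝ) + 1 / 2) * (Real.pi / α) := by positivity
  rw [norm_div]
  refine div_le_div₀ zero_le_one (hf k) (by positivity) ?_
  refine le_trans (le_of_eq ?_) (Complex.re_le_norm _)
  rw [← Complex.ofReal_pow, Complex.sub_re, Complex.re_ofReal_mul, Complex.I_re, mul_zero, sub_zero,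
    Complex.ofReal_re]

theorem norm_cexp_neg_sq_sub (t θ : ℝ) :
    ‖Complex.exp (-((t : ℂ) ^ 2 - θ * Complex.I))‖ = Real.exp (-t ^ 2) := by
  rw [Complex.norm_exp, ← Complex.ofReal_pow, Complex.neg_re, Complex.sub_re, Complex.re_ofReal_mul,
    Complex.I_re, mul_zero, sub_zero, Complex.ofReal_re]

theorem fresnel_sub_approx_eq (N : ℕ) {x : ℝ} (hx : x ≠ 0) :
    ((C x - CN N x : ℝ) : ℂ) + ((S x - SN N x : ℝ) : ℂ) * Complex.I =
      -((∑' n : ℕ, 2 * x * ((-1) ^ (n + 1) * ∫ v in (0 : ℝ)..1,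
        ((Real.exp (-((((n : ℝ) + 1) * A N) ^ 2 / v ^ 2)) : ℝ) : ℂ) *
          Complex.exp (((Real.pi / 2 * x ^ 2 : ℝ) : ℂ) * v ^ 2 * Complex.I))) +
      ∑' k : ℕ, ((Real.sqrt Real.pi * x / A N : ℝ) : ℂ) *
        (Complex.exp (-(((((((k + N : ℕ) : ℝ) + 1 / 2) * (Real.pi / A N) : ℝ) : ℂ)) ^ 2 -
          ((Real.pi / 2 * x ^ 2 : ℝ) : ℂ) * Complex.I)) /
        (((((((k + N : ℕ) : ℝ) + 1 / 2) * (Real.pi / A N) : ℝ) : ℂ)) ^ 2 -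
          ((Real.pi / 2 * x ^ 2 : ℝ) : ℂ) * Complex.I))) := by
  have hA := A_pos N
  have hpi := Real.pi_pos
  have hmain := hasSum_one_sub_cexp_neg_div hA (Real.pi / 2 * x ^ 2)
  have htan := sqrt_pi_mul_div_mul_tsum_one_div hA hx
  have hsum := sqrt_pi_mul_sum_cexp_neg_div N x
  have hC := cexp_fresnel_integral x
  have hs1 := summable_div_sq_sub_mul_I hA (Real.pi / 2 * x ^ 2) (f := fun _ ↦ 1) (by simp)
  have hs2 := summable_div_sq_sub_mul_I hA (Real.pi / 2 * x ^ 2)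
    (f := fun k ↦ Complex.exp (-((((((k : ℝ) + 1 / 2) * (Real.pi / A N) : ℝ) : ℂ)) ^ 2 -
          ((Real.pi / 2 * x ^ 2 : ℝ) : ℂ) * Complex.I))) (fun k ↦ by
      rw [norm_cexp_neg_sq_sub, Real.exp_le_one_iff, neg_nonpos]
      positivity)
  have hsplit := hs2.sum_add_tsum_nat_add N
  have hsub := hmain.tsum_eq
  simp only [sub_div] at hsub
  rw [hs1.tsum_sub hs2, ← hsplit] at hsub
  have hmul := congrArg (fun r : ℂ ↦ ((Real.sqrt Real.pi * x / A N : ℝ) : ℂ) * r) hsub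
  rw [mul_sub, htan, mul_add, hsum] at hmul
  have hα' : ((A N : ℝ) : ℂ) ≠ 0 := by exact_mod_cast hA.ne'
  have hs : ((Real.sqrt Real.pi : ℝ) : ℂ) ≠ 0 := by
    exact_mod_cast (Real.sqrt_pos.mpr hpi).ne'
  have hone : ((Real.sqrt Real.pi * x / A N : ℝ) : ℂ) * ((A N / Real.sqrt Real.pi : ℝ) : ℂ) = x := by
    push_cast
    field_simp
  rw [← mul_assoc, hone, mul_add (x : ℂ), hC] at hmul
  rw [tsum_mul_left, tsum_mul_left, CN, SN]
  push_cast at hmul ⊢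
  linear_combination -hmul

theorem norm_tail_term_le (N k : ℕ) (x : ℝ) :
    ‖((Real.sqrt Real.pi * x / A N : ℝ) : ℂ) *
        (Complex.exp (-(((((((k + N : ℕ) : ℝ) + 1 / 2) * (Real.pi / A N) : ℝ) : ℂ)) ^ 2 -
          ((Real.pi / 2 * x ^ 2 : ℝ) : ℂ) * Complex.I)) /
        (((((((k + N : ℕ) : ℝ) + 1 / 2) * (Real.pi / A N) : ℝ) : ℂ)) ^ 2 -
          ((Real.pi / 2 * x ^ 2 : ℝ) : ℂ) * Complex.I))‖ ≤
      Real.exp (-A N ^ 2) / A N ^ 2 * Real.exp (-(2 * Real.pi)) ^ k := by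
  have hA := A_pos N
  have hpi := Real.pi_pos
  have hAsq := A_sq N
  have ht : (((k + N : ℕ) : ℝ) + 1 / 2) * (Real.pi / A N) = A N + k * (Real.pi / A N) := by
    push_cast
    field_simp
    linear_combination -2 * hAsq
  rw [ht, norm_mul, norm_div, norm_cexp_neg_sq_sub, Complex.norm_real, Real.norm_eq_abs]
  have hpA : 0 ≤ k * (Real.pi / A N) := by positivity
  have ht2 : A N ^ 2 + k * (2 * Real.pi) ≤ (A N + k * (Real.pi / A N)) ^ 2 := by
    have : A N * (k * (Real.pi / A N)) = k * Real.pi := by field_simp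
    nlinarith [sq_nonneg (k * (Real.pi / A N))]
  have htA : A N ≤ A N + k * (Real.pi / A N) := by linarith
  generalize A N + k * (Real.pi / A N) = t at *
  have ht0 : 0 < t := hA.trans_le htA
  have hw : Real.sqrt Real.pi * |x| * t ≤ ‖(t : ℂ) ^ 2 - ((Real.pi / 2 * x ^ 2 : ℝ) : ℂ) * Complex.I‖ := by
    apply Real.le_sqrt_of_sq_le
    have e1 : ((t : ℂ) ^ 2 - ((Real.pi / 2 * x ^ 2 : ℝ) : ℂ) * Complex.I).re = t ^ 2 := by
      rw [← Complex.ofReal_pow, Complex.sub_re, Complex.re_ofReal_mul, Complex.I_re, mul_zero,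
        sub_zero, Complex.ofReal_re]
    have e2 : ((t : ℂ) ^ 2 - ((Real.pi / 2 * x ^ 2 : ℝ) : ℂ) * Complex.I).im =
        -(Real.pi / 2 * x ^ 2) := by
      rw [← Complex.ofReal_pow, Complex.sub_im, Complex.im_ofReal_mul, Complex.I_im, mul_one,
        Complex.ofReal_im, zero_sub]
    rw [Complex.normSq_apply, e1, e2, mul_pow, mul_pow, Real.sq_sqrt hpi.le, sq_abs]
    nlinarith [sq_nonneg (t ^ 2 - Real.pi / 2 * x ^ 2)]
  have hexp : Real.exp (-t ^ 2) ≤ Real.exp (-A N ^ 2) * Real.exp (-(2 * Real.pi)) ^ k := by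
    rw [← Real.exp_nat_mul, ← Real.exp_add]
    apply Real.exp_le_exp.mpr
    linarith
  have hwpos : 0 < ‖(t : ℂ) ^ 2 - ((Real.pi / 2 * x ^ 2 : ℝ) : ℂ) * Complex.I‖ :=
    norm_pos_iff.mpr (sq_sub_mul_I_ne_zero ht0 _)
  have hsx : 0 ≤ Real.sqrt Real.pi * |x| := by positivity
  have habs : |Real.sqrt Real.pi * x / A N| = Real.sqrt Real.pi * |x| / A N := by
    rw [abs_div, abs_mul, abs_of_pos hA, abs_of_nonneg (Real.sqrt_nonneg _)]
  rw [habs]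
  generalize ‖(t : ℂ) ^ 2 - ((Real.pi / 2 * x ^ 2 : ℝ) : ℂ) * Complex.I‖ = w at *
  have hw' : Real.sqrt Real.pi * |x| * A N ≤ w :=
    (mul_le_mul_of_nonneg_left htA hsx).trans hw
  calc Real.sqrt Real.pi * |x| / A N * (Real.exp (-t ^ 2) / w)
      = Real.sqrt Real.pi * |x| * A N * Real.exp (-t ^ 2) / (A N ^ 2 * w) := by field_simp
    _ ≤ w * (Real.exp (-A N ^ 2) * Real.exp (-(2 * Real.pi)) ^ k) / (A N ^ 2 * w) := by gcongr
    _ = _ := by field_simp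

theorem three_lt_A_sq {N : ℕ} (hN : 1 ≤ N) : 3 < A N ^ 2 := by
  rw [A_sq]
  have : (1 : ℝ) ≤ N := by exact_mod_cast hN
  nlinarith [Real.pi_gt_three]

theorem norm_oscillatory_term_le {N : ℕ} (hN : 1 ≤ N) (n : ℕ) {x : ℝ} (hx : x ≠ 0) :
    ‖2 * (x : ℂ) * ((-1) ^ (n + 1) * ∫ v in (0 : ℝ)..1,
        ((Real.exp (-((((n : ℝ) + 1) * A N) ^ 2 / v ^ 2)) : ℝ) : ℂ) *
          Complex.exp (((Real.pi / 2 * x ^ 2 : ℝ) : ℂ) * v ^ 2 * Complex.I))‖ ≤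
      4 / (Real.pi * A N) * Real.exp (-A N ^ 2) * (1 / 4) ^ n := by
  have hA := A_pos N
  have hpi := Real.pi_pos
  have hA3 := three_lt_A_sq hN
  have hn : (0 : ℝ) ≤ n := n.cast_nonneg
  have ha : A N ^ 2 + n * A N ^ 2 ≤ (((n : ℝ) + 1) * A N) ^ 2 := by
    nlinarith [mul_nonneg (mul_nonneg hn (show 0 ≤ (n : ℝ) + 1 by linarith)) (sq_nonneg (A N))]
  have haA : A N ^ 2 ≤ (((n : ℝ) + 1) * A N) ^ 2 := by nlinarith
  have hx0 : 0 < |x| := abs_pos.mpr hx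
  have hJ1 := norm_integral_exp_neg_div_sq_mul_cexp_le
    (a := (((n : ℝ) + 1) * A N) ^ 2) (by positivity) (Real.pi / 2 * x ^ 2)
  have hJ2 := norm_integral_exp_neg_div_sq_mul_cexp_le_div
    (a := (((n : ℝ) + 1) * A N) ^ 2) (θ := Real.pi / 2 * x ^ 2) (by linarith) (by positivity)
  rw [norm_mul, norm_mul, norm_mul, norm_pow, norm_neg, norm_one, one_pow, one_mul,
    Complex.norm_ofNat, Complex.norm_real, Real.norm_eq_abs]
  have hexp : Real.exp (-(((n : ℝ) + 1) * A N) ^ 2) ≤ Real.exp (-A N ^ 2) * (1 / 4) ^ n := by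
    have h4 : Real.exp (-A N ^ 2) ≤ 1 / 4 := by
      rw [Real.exp_neg, one_div]
      exact inv_anti₀ (by norm_num) (by linarith [Real.add_one_le_exp (A N ^ 2)])
    calc _ ≤ Real.exp (-A N ^ 2) * Real.exp (-A N ^ 2) ^ n := by
          rw [← Real.exp_nat_mul, ← Real.exp_add]
          apply Real.exp_le_exp.mpr
          linarith
      _ ≤ _ := by gcongr
  generalize (((n : ℝ) + 1) * A N) ^ 2 = a at *
  have hJ0 := norm_nonneg (∫ v in (0 : ℝ)..1, ((Real.exp (-(a / v ^ 2)) : ℝ) : ℂ) *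
    Complex.exp (((Real.pi / 2 * x ^ 2 : ℝ) : ℂ) * v ^ 2 * Complex.I))
  generalize ‖∫ v in (0 : ℝ)..1, ((Real.exp (-(a / v ^ 2)) : ℝ) : ℂ) *
    Complex.exp (((Real.pi / 2 * x ^ 2 : ℝ) : ℂ) * v ^ 2 * Complex.I)‖ = J at *
  rw [mul_assoc (4 / (Real.pi * A N))]
  refine le_trans ?_ (mul_le_mul_of_nonneg_left hexp (a := 4 / (Real.pi * A N)) (by positivity))
  rcases le_total |x| (A N) with h | h
  · calc 2 * |x| * J ≤ 2 * A N * (Real.exp (-a) / (2 * A N ^ 2)) := by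
          have : Real.exp (-a) / (2 * a) ≤ Real.exp (-a) / (2 * A N ^ 2) := by gcongr
          have hJ := hJ1.trans this
          gcongr
      _ = Real.pi / (Real.pi * A N) * Real.exp (-a) := by field_simp
      _ ≤ _ := by gcongr; exact Real.pi_le_four
  · calc 2 * |x| * J ≤ 2 * |x| * (Real.exp (-a) / (Real.pi / 2 * x ^ 2)) := by gcongr
      _ = 4 / (Real.pi * |x|) * Real.exp (-a) := by
          rw [← sq_abs x]; field_simp; ring
      _ ≤ _ := by gcongr

theorem norm_fresnel_sub_approx_le {N : ℕ} (hN : 1 ≤ N) {x : ℝ} (hx : x ≠ 0) :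
    ‖((C x - CN N x : ℝ) : ℂ) + ((S x - SN N x : ℝ) : ℂ) * Complex.I‖ ≤
      16 / (3 * Real.pi * A N) * Real.exp (-A N ^ 2) +
        (2 * Real.pi + 1) / (2 * Real.pi) * (Real.exp (-A N ^ 2) / A N ^ 2) := by
  have hA := A_pos N
  have hpi := Real.pi_pos
  rw [fresnel_sub_approx_eq N hx, norm_neg]
  refine (norm_add_le _ _).trans (add_le_add ?_ ?_)
  · have hg := (hasSum_geometric_of_lt_one (r := (1 / 4 : ℝ)) (by norm_num) (by norm_num)).mul_left
      (4 / (Real.pi * A N) * Real.exp (-A N ^ 2))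
    refine (tsum_of_norm_bounded hg fun n ↦ norm_oscillatory_term_le hN n hx).trans (le_of_eq ?_)
    field_simp
    norm_num
  · have hr : Real.exp (-(2 * Real.pi)) ≤ 1 / (2 * Real.pi + 1) := by
      rw [Real.exp_neg, one_div]
      exact inv_anti₀ (by positivity) (Real.add_one_le_exp _)
    have hr1 : 1 / (2 * Real.pi + 1) < 1 := by
      rw [div_lt_one (by positivity)]; linarith
    have hg := (hasSum_geometric_of_lt_one (Real.exp_pos (-(2 * Real.pi))).le
      (hr.trans_lt hr1)).mul_left (Real.exp (-A N ^ 2) / A N ^ 2)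
    refine (tsum_of_norm_bounded hg fun k ↦ norm_tail_term_le N k x).trans ?_
    rw [mul_comm]
    gcongr
    rw [inv_le_comm₀ (by linarith) (by positivity), inv_div]
    calc 2 * Real.pi / (2 * Real.pi + 1) = 1 - 1 / (2 * Real.pi + 1) := by field_simp; ring
      _ ≤ _ := by linarith

theorem error_bound_le {N : ℕ} :
    16 / (3 * Real.pi * A N) * Real.exp (-A N ^ 2) +
        (2 * Real.pi + 1) / (2 * Real.pi) * (Real.exp (-A N ^ 2) / A N ^ 2) ≤
      2 * c N * Real.exp (-Real.pi * N) / Real.sqrt (2 * (N : ℝ) + 1) := by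
  have hA := A_pos N
  have hpi := Real.pi_pos
  have hs : 0 < Real.sqrt Real.pi := Real.sqrt_pos.mpr hpi
  have hssq := Real.sq_sqrt hpi.le
  have h2 : 0 < Real.sqrt 2 := by positivity
  have h2sq := Real.sq_sqrt (show (0 : ℝ) ≤ 2 by norm_num)
  have hroot : Real.sqrt (2 * (N : ℝ) + 1) = Real.sqrt 2 * A N / Real.sqrt Real.pi := by
    rw [A, ← Real.sqrt_mul (by norm_num), ← Real.sqrt_div (by positivity)]
    congr 1
    field_simp
  have hexp : Real.exp (-A N ^ 2) = Real.exp (-Real.pi / 2) * Real.exp (-Real.pi * N) := by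
    rw [← Real.exp_add, A_sq]
    congr 1
    ring
  have hD1 : Real.exp (-2 * A N ^ 2) < 1 := by
    rw [Real.exp_lt_one_iff]
    nlinarith [pow_pos hA 2]
  have hD : 1 ≤ 1 / (1 - Real.exp (-2 * A N ^ 2)) := by
    rw [le_div_iff₀ (by linarith)]
    linarith [Real.exp_pos (-2 * A N ^ 2)]
  have hK : 1 ≤ 1 + 2 * Real.sqrt Real.pi * Real.exp (-β * A N ^ 2) := by
    have : 0 ≤ 2 * Real.sqrt Real.pi * Real.exp (-β * A N ^ 2) := by positivity
    linarith
  have hs65 : 6 / 5 ≤ Real.sqrt Real.pi :=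
    Real.le_sqrt_of_sq_le (by linarith [Real.pi_gt_three])
  have hrhs : 2 * c N * Real.exp (-Real.pi * N) / Real.sqrt (2 * (N : ℝ) + 1) =
      40 * Real.sqrt Real.pi / (9 * Real.pi * A N) * Real.exp (-A N ^ 2) *
        (1 / (1 - Real.exp (-2 * A N ^ 2)) *
          (1 + 2 * Real.sqrt Real.pi * Real.exp (-β * A N ^ 2))) +
        (2 * Real.pi + 1) / (2 * Real.pi) * (Real.exp (-A N ^ 2) / A N ^ 2) := by
    rw [hroot, hexp, c]
    generalize 1 + 2 * Real.sqrt Real.pi * Real.exp (-β * A N ^ 2) = K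
    have hDne : 1 - Real.exp (-2 * A N ^ 2) ≠ 0 := by linarith
    generalize 1 - Real.exp (-2 * A N ^ 2) = D at *
    field_simp
    rw [h2sq]
    ring
  rw [hrhs]
  refine add_le_add ?_ le_rfl
  calc 16 / (3 * Real.pi * A N) * Real.exp (-A N ^ 2)
      = 40 * (6 / 5) / (9 * Real.pi * A N) * Real.exp (-A N ^ 2) := by field_simp; norm_num
    _ ≤ 40 * Real.sqrt Real.pi / (9 * Real.pi * A N) * Real.exp (-A N ^ 2) := by gcongr
    _ ≤ _ := le_mul_of_one_le_right (by positivity) (one_le_mul_of_one_le_of_one_le hD hK)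

theorem stmt_14 (N : ℕ) (hN : 1 ≤ N) (x : ℝ) :
    |C x - CN N x| ≤ 2 * c N * Real.exp (-Real.pi * N) / Real.sqrt (2 * (N : ℝ) + 1) ∧
      |S x - SN N x| ≤ 2 * c N * Real.exp (-Real.pi * N) / Real.sqrt (2 * (N : ℝ) + 1) := by
  rcases eq_or_ne x 0 with rfl | hx
  · have hA := A_pos N
    have hpi := Real.pi_pos
    have h0 := le_trans (by positivity) (error_bound_le (N := N))
    have hC : C 0 - CN N 0 = 0 := by simp [C, CN]
    have hS : S 0 - SN N 0 = 0 := by simp [S, SN]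
    rw [hC, hS, abs_zero]
    exact ⟨h0, h0⟩
  · have h := (norm_fresnel_sub_approx_le hN hx).trans error_bound_le
    have hre := Complex.abs_re_le_norm
      (((C x - CN N x : ℝ) : ℂ) + ((S x - SN N x : ℝ) : ℂ) * Complex.I)
    have him := Complex.abs_im_le_norm
      (((C x - CN N x : ℝ) : ℂ) + ((S x - SN N x : ℝ) : ℂ) * Complex.I)
    rw [← Complex.mk_eq_add_mul_I] at h hre him
    exact ⟨hre.trans h, him.trans h⟩

end
end

section
/- For every integer N ≥ 4 and every real x with |x| < 1, |S(x) − S_N(x)| ≤ (|x|³/(1 − |x|⁴)) · √2 · ĉ_N · e^{-π(N − 1/4)}/√(N + 1/2). -/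
noncomputable section

/-- The constant `ĉ_N`. -/
def chat (N : ℕ) : ℝ :=
  c N + Real.sqrt 2 * (2 * Real.pi + 1) /
    ((Real.pi * Real.sqrt Real.pi) * Real.exp (Real.pi / 2) * Real.sqrt ((N : ℝ) + 1 / 2))

open Complex in
lemma hasSum_tanh {z : ℂ} (hz : z.re ≠ 0) :
    HasSum (fun k : ℕ => 2 * z / ((((k : ℂ) + 1 / 2) * Real.pi) ^ 2 + z ^ 2)) (tanh z) := by
  have hpi : (Real.pi : ℂ) ≠ 0 := by exact_mod_cast Real.pi_ne_zero
  set a : ℂ := z * I / Real.pi with ha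
  have him : ∀ r : ℝ, a ≠ r := by
    intro r h
    have h1 : z * I = ((r * Real.pi : ℝ) : ℂ) := by
      push_cast; rw [← h, ha]; field_simp
    apply hz
    have := congrArg Complex.im h1
    simpa using this
  have hmem : a ∈ integerComplement := by
    rintro ⟨n, hn⟩
    exact him n (by simpa using hn.symm)
  have hmem2 : 2 * a ∈ integerComplement := by
    rintro ⟨n, hn⟩
    refine him (n / 2) ?_
    push_cast
    have : (n : ℂ) = 2 * a := by simpa using hn
    rw [this]; ring
  have hs1 : HasSum (fun n => cotTerm a n) (Real.pi * cot (Real.pi * a) - 1 / a) := by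
    rw [cot_series_rep' hmem]; exact (summable_cotTerm hmem).hasSum
  have hS2 := (summable_cotTerm hmem2)
  have hs2 : HasSum (fun n => cotTerm (2 * a) n)
      (Real.pi * cot (Real.pi * (2 * a)) - 1 / (2 * a)) := by
    rw [cot_series_rep' hmem2]; exact hS2.hasSum
  have he : Summable (fun k : ℕ => cotTerm (2 * a) (2 * k)) :=
    hS2.comp_injective (fun a b h => by simpa using h)
  have ho : HasSum (fun k : ℕ => cotTerm (2 * a) (2 * k + 1))
      ((Real.pi * cot (Real.pi * a) - 1 / a) / 2) := by
    refine HasSum.congr_fun (hs1.div_const 2) fun k => ?_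
    have e1 : 2 * a - ((2 * k + 1 : ℕ) + 1) = 2 * (a - (k + 1)) := by push_cast; ring
    have e2 : 2 * a + ((2 * k + 1 : ℕ) + 1) = 2 * (a + (k + 1)) := by push_cast; ring
    simp only [cotTerm, e1, e2, one_div, mul_inv]
    ring
  have h3 := (he.hasSum.even_add_odd ho).unique hs2
  have hsin : sin (Real.pi * a) ≠ 0 := sin_pi_mul_ne_zero hmem
  have hsin2 : sin (Real.pi * (2 * a)) ≠ 0 := sin_pi_mul_ne_zero hmem2
  have e2 : (Real.pi : ℂ) * (2 * a) = 2 * (Real.pi * a) := by ring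
  have hza : (Real.pi : ℂ) * a = z * I := by rw [ha]; field_simp
  have h4 : ∑' k : ℕ, cotTerm (2 * a) (2 * k) = -(Real.pi * I / 2) * tanh z := by
    have h5 : tanh z * I = sin (Real.pi * a) / cos (Real.pi * a) := by
      rw [← tan_mul_I, tan_eq_sin_div_cos, hza]
    have h6 : ∑' k : ℕ, cotTerm (2 * a) (2 * k) =
        Real.pi * cot (Real.pi * (2 * a)) - Real.pi * cot (Real.pi * a) / 2 := by
      linear_combination h3
    have h7 : -(Real.pi * I / 2) * tanh z = -(Real.pi / 2) * (tanh z * I) := by ring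
    rw [h6, h7, h5, e2, cot_eq_cos_div_sin, cot_eq_cos_div_sin, sin_two_mul, cos_two_mul']
    field_simp
    ring
  have h8 := he.hasSum.mul_left ((-(Real.pi * I / 2))⁻¹)
  rw [h4, inv_mul_cancel_left₀ (by simp [hpi])] at h8
  refine HasSum.congr_fun h8 fun k => ?_
  have d1 : 2 * a - ((2 * k : ℕ) + 1) ≠ 0 := by
    intro h
    apply him ((2 * k + 1) / 2)
    push_cast at h ⊢
    linear_combination h / 2
  have d2 : 2 * a + ((2 * k : ℕ) + 1) ≠ 0 := by
    intro h
    apply him (-((2 * k + 1) / 2))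
    push_cast at h ⊢
    linear_combination h / 2
  have hzz : z = -(Real.pi * a * I) := by
    rw [hza, mul_assoc, I_mul_I]; ring
  have hz2 : z ^ 2 = -(Real.pi * a) ^ 2 := by
    rw [hza, mul_pow, I_sq]; ring
  have e : (((k : ℂ) + 1 / 2) * Real.pi) ^ 2 + z ^ 2 =
      -(Real.pi ^ 2 / 4) * ((2 * a - ((2 * k : ℕ) + 1)) * (2 * a + ((2 * k : ℕ) + 1))) := by
    rw [hz2]; push_cast; ring
  rw [e, cotTerm]
  nth_rewrite 1 [hzz]
  rw [one_div_add_one_div d1 d2]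
  field_simp
  push_cast
  linear_combination (4 * a) * I_sq

lemma abs_tsum_gaussian_midpoint_sub_le {a : ℝ} (ha : 0 < a)
    (hq : Real.exp (-Real.pi * a) ≤ 1 / 3) :
    |∑' k : ℕ, 2 * Real.exp (-(Real.pi / a) * ((k : ℝ) + 1 / 2) ^ 2) - Real.sqrt a| ≤
      3 * Real.sqrt a * Real.exp (-Real.pi * a) := by
  have hb : 0 < Real.pi / a := by positivity
  set q := Real.exp (-Real.pi * a) with hqdef
  have hq0 : 0 < q := Real.exp_pos _
  have hP := Complex.tsum_exp_neg_quadratic (a := (a : ℂ)) (by simpa using ha) (-Complex.I / 2)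
  have hsq : (a : ℂ) ^ (1 / 2 : ℂ) = (Real.sqrt a : ℂ) := by
    rw [Real.sqrt_eq_rpow, Complex.ofReal_cpow ha.le]; norm_num
  have hsum : Summable fun k : ℕ => Real.exp (-(Real.pi / a) * ((k : ℝ) + 1 / 2) ^ 2) := by
    refine Summable.of_nonneg_of_le (fun _ => (Real.exp_pos _).le) (fun k => ?_)
      (Real.summable_exp_nat_mul_iff.2 (neg_lt_zero.2 hb))
    apply Real.exp_le_exp.2
    have : (k : ℝ) ≤ ((k : ℝ) + 1 / 2) ^ 2 := by nlinarith [sq_nonneg (k : ℝ)]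
    nlinarith
  have hR : ∑' n : ℤ, Complex.exp (-Real.pi / a * (n + Complex.I * (-Complex.I / 2)) ^ 2) =
      ((∑' k : ℕ, 2 * Real.exp (-(Real.pi / a) * ((k : ℝ) + 1 / 2) ^ 2) : ℝ) : ℂ) := by
    have hs : HasSum (fun k : ℕ => (Real.exp (-(Real.pi / a) * ((k : ℝ) + 1 / 2) ^ 2) : ℂ))
        ((∑' k : ℕ, Real.exp (-(Real.pi / a) * ((k : ℝ) + 1 / 2) ^ 2) : ℝ) : ℂ) :=
      Complex.hasSum_ofReal.2 hsum.hasSum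
    have hI : Complex.I * (-Complex.I / 2) = 1 / 2 := by
      linear_combination (-1 / 2 : ℂ) * Complex.I_sq
    rw [tsum_mul_left, two_mul, Complex.ofReal_add]
    refine (HasSum.of_nat_of_neg_add_one ?_ ?_).tsum_eq
    · convert hs using 2 with k
      rw [hI]; push_cast; congr 1; ring
    · convert hs using 2 with k
      rw [hI]; push_cast; congr 1; ring
  rw [hR, hsq] at hP
  set T := ∑' k : ℕ, 2 * Real.exp (-(Real.pi / a) * ((k : ℝ) + 1 / 2) ^ 2)
  set f : ℤ → ℂ := fun n => Complex.exp (-Real.pi * a * n ^ 2 + 2 * Real.pi * (-Complex.I / 2) * n)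
    with hf
  have hnorm : ∀ n : ℤ, ‖f n‖ = Real.exp (-Real.pi * a * n ^ 2) := by
    intro n
    simp only [hf, Complex.norm_exp]
    congr 1
    simp [pow_two]
  have hgeo : HasSum (fun n : ℕ => q ^ (n + 1)) (q / (1 - q)) := by
    have := (hasSum_geometric_of_lt_one hq0.le (by linarith)).mul_left q
    simpa only [pow_succ', div_eq_mul_inv] using this
  have hle : ∀ n : ℕ, Real.exp (-Real.pi * a * ((n : ℝ) + 1) ^ 2) ≤ q ^ (n + 1) := by
    intro n
    rw [hqdef, ← Real.exp_nat_mul]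
    apply Real.exp_le_exp.2
    push_cast
    have : 0 < Real.pi * a := by positivity
    have : (0 : ℝ) ≤ n := by positivity
    nlinarith [mul_nonneg ‹0 < Real.pi * a›.le (mul_nonneg this (by linarith : (0 : ℝ) ≤ n + 1))]
  have hb1 : ∀ n : ℕ, ‖f (n + 1)‖ ≤ q ^ (n + 1) := fun n => by
    rw [hnorm]; push_cast; exact hle n
  have hb2 : ∀ n : ℕ, ‖f (-(n + 1))‖ ≤ q ^ (n + 1) := fun n => by
    rw [hnorm]; push_cast; rw [neg_sq]; exact hle n
  have hs1 : Summable fun n : ℕ => f (n + 1) := Summable.of_norm_bounded hgeo.summable hb1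
  have hs2 : Summable fun n : ℕ => f (-(n + 1)) := Summable.of_norm_bounded hgeo.summable hb2
  have hsplit := tsum_of_add_one_of_neg_add_one hs1 hs2
  have hf0 : f 0 = 1 := by simp [hf]
  have n1 := tsum_of_norm_bounded hgeo hb1
  have n2 := tsum_of_norm_bounded hgeo hb2
  have hsa : 0 < Real.sqrt a := Real.sqrt_pos.2 ha
  have hsa' : (Real.sqrt a : ℂ) ≠ 0 := by exact_mod_cast hsa.ne'
  have key : ((T - Real.sqrt a : ℝ) : ℂ) =
      Real.sqrt a * (∑' n : ℕ, f (n + 1) + ∑' n : ℕ, f (-(n + 1))) := by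
    have h1 : (T : ℂ) = Real.sqrt a * ∑' n : ℤ, f n := by
      rw [hP]; field_simp
    push_cast
    rw [h1, hsplit, hf0]
    ring
  have h2 : q / (1 - q) ≤ 3 / 2 * q := by
    rw [div_le_iff₀ (by linarith)]
    nlinarith
  calc |T - Real.sqrt a| = ‖((T - Real.sqrt a : ℝ) : ℂ)‖ := by
        rw [Complex.norm_real, Real.norm_eq_abs]
    _ = Real.sqrt a * ‖∑' n : ℕ, f (n + 1) + ∑' n : ℕ, f (-(n + 1))‖ := by
        rw [key, norm_mul, Complex.norm_real, Real.norm_of_nonneg hsa.le]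
    _ ≤ Real.sqrt a * (3 * q) := by
        gcongr
        exact (norm_add_le _ _).trans (by linarith)
    _ = _ := by ring

lemma cos_add_cosh_pos {u : ℝ} (hu : u ≠ 0) : 0 < Real.cos u + Real.cosh u := by
  linarith [Real.neg_one_le_cos u, Real.one_lt_cosh.2 hu]

open Complex in
lemma tanh_diagonal {u : ℝ} (hu : u ≠ 0) :
    tanh ((u / 2 : ℝ) * (1 + I)) =
      (Real.sinh u + Real.sin u * I) / ((Real.cos u + Real.cosh u : ℝ) : ℂ) := by
  have hD : ((Real.cos u + Real.cosh u : ℝ) : ℂ) ≠ 0 := by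
    exact_mod_cast (cos_add_cosh_pos hu).ne'
  set z : ℂ := (u / 2 : ℝ) * (1 + I) with hz
  set w : ℂ := (u / 2 : ℝ) * (1 - I) with hw
  have h1 : z + w = u := by rw [hz, hw]; push_cast; ring
  have h2 : z - w = u * I := by rw [hz, hw]; push_cast; ring
  have hs : 2 * (sinh z * cosh w) = Real.sinh u + Real.sin u * I := by
    have e1 := sinh_add z w
    have e2 := sinh_sub z w
    rw [h1] at e1
    rw [h2, sinh_mul_I] at e2
    push_cast
    linear_combination -e1 - e2
  have hc : 2 * (cosh z * cosh w) = ((Real.cos u + Real.cosh u : ℝ) : ℂ) := by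
    have e1 := cosh_add z w
    have e2 := cosh_sub z w
    rw [h1] at e1
    rw [h2, cosh_mul_I] at e2
    push_cast
    linear_combination -e1 - e2
  have hzw : cosh z ≠ 0 ∧ cosh w ≠ 0 := by
    constructor <;> · intro h; apply hD; rw [← hc, h]; ring
  obtain ⟨hcz, hcw⟩ := hzw
  rw [← hs, ← hc, tanh_eq_sinh_div_cosh]
  field_simp

lemma im_ofReal_mul_add (r a b : ℝ) :
    ((r : ℂ) * ((a : ℂ) + (b : ℂ) * Complex.I)).im = r * b := by
  simp

lemma hasSum_fresnel_correction {α x : ℝ} (hα : 0 < α) (hx : x ≠ 0) :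
    HasSum (fun k : ℕ => 2 * (Real.pi / α) * ((Real.pi / 2 * x ^ 2) /
        ((((k : ℝ) + 1 / 2) * Real.pi / α) ^ 4 + (Real.pi / 2 * x ^ 2) ^ 2)))
      (Real.sqrt Real.pi / x *
        ((Real.sinh (Real.sqrt Real.pi * α * x) - Real.sin (Real.sqrt Real.pi * α * x)) /
          (Real.cos (Real.sqrt Real.pi * α * x) + Real.cosh (Real.sqrt Real.pi * α * x)))) := by
  have hpi := Real.pi_pos
  have hsq : Real.sqrt Real.pi ^ 2 = Real.pi := Real.sq_sqrt hpi.le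
  set u := Real.sqrt Real.pi * α * x with hu
  have hu0 : u ≠ 0 := by positivity
  set s := Real.pi / 2 * x ^ 2 with hs
  have hus : u ^ 2 = 2 * α ^ 2 * s := by
    rw [hu, hs]; linear_combination (α ^ 2 * x ^ 2) * hsq
  set z : ℂ := (u / 2 : ℝ) * (1 + Complex.I) with hz
  have hz2 : z ^ 2 = ((α ^ 2 * s : ℝ) : ℂ) * Complex.I := by
    have : ((u ^ 2 : ℝ) : ℂ) = ((2 * α ^ 2 * s : ℝ) : ℂ) := by rw [hus]
    push_cast at this ⊢
    rw [hz]; push_cast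
    linear_combination (Complex.I / 2) * this + (u ^ 2 / 4 : ℂ) * Complex.I_sq
  have hre : z.re ≠ 0 := by simp [hz, hu0]
  have hz0 : z ≠ 0 := fun h => hre (by rw [h]; simp)
  have h := Complex.hasSum_im ((hasSum_tanh hre).mul_left (((Real.pi * α : ℝ) : ℂ) / z))
  have hval : -((((Real.pi * α : ℝ) : ℂ) / z) * Complex.tanh z).im =
      Real.sqrt Real.pi / x * ((Real.sinh u - Real.sin u) / (Real.cos u + Real.cosh u)) := by
    have hD := (cos_add_cosh_pos hu0).ne'
    have hupi : Real.pi * α / (u * (Real.cos u + Real.cosh u)) =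
        Real.sqrt Real.pi / x / (Real.cos u + Real.cosh u) := by
      rw [div_div, div_eq_div_iff (by positivity) (by positivity)]
      nth_rewrite 2 [hu]
      linear_combination (-α * x * (Real.cos u + Real.cosh u)) * hsq
    have hI : (1 + Complex.I) ≠ 0 := by
      intro h; simpa using congrArg Complex.re h
    have e : ((Real.pi * α : ℝ) : ℂ) / z * Complex.tanh z =
        ((Real.pi * α / (u * (Real.cos u + Real.cosh u)) : ℝ) : ℂ) *
          (((Real.sinh u + Real.sin u : ℝ) : ℂ) +
            ((Real.sin u - Real.sinh u : ℝ) : ℂ) * Complex.I) := by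
      have hD' : ((Real.cos u + Real.cosh u : ℝ) : ℂ) ≠ 0 := by exact_mod_cast hD
      have hu' : (u : ℂ) ≠ 0 := by exact_mod_cast hu0
      rw [hz, tanh_diagonal hu0, Complex.ofReal_div (Real.pi * α), Complex.ofReal_mul u,
        Complex.ofReal_div u]
      generalize ((Real.cos u + Real.cosh u : ℝ) : ℂ) = D at *
      field_simp
      push_cast
      linear_combination (Real.pi * α * (Complex.sinh u - Complex.sin u)) * Complex.I_sq
    rw [e, im_ofReal_mul_add, hupi]
    field_simp
    ring
  have hterm : ∀ k : ℕ, 2 * (Real.pi / α) * (s / ((((k : ℝ) + 1 / 2) * Real.pi / α) ^ 4 + s ^ 2)) =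
      -(((Real.pi * α : ℝ) : ℂ) / z *
        (2 * z / ((((k : ℂ) + 1 / 2) * Real.pi) ^ 2 + z ^ 2))).im := by
    intro k
    set t := ((k : ℝ) + 1 / 2) * Real.pi / α with ht
    have hden : t ^ 4 + s ^ 2 ≠ 0 := by positivity
    have hα' : (α : ℂ) ≠ 0 := by exact_mod_cast hα.ne'
    have hden' : ((t : ℂ) ^ 4 + (s : ℂ) ^ 2) ≠ 0 := by exact_mod_cast hden
    have hfac : ((t : ℂ) ^ 2 + s * Complex.I) * ((t : ℂ) ^ 2 - s * Complex.I) =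
        (t : ℂ) ^ 4 + (s : ℂ) ^ 2 := by
      linear_combination -(s : ℂ) ^ 2 * Complex.I_sq
    have hT : (((k : ℂ) + 1 / 2) * Real.pi) ^ 2 + z ^ 2 =
        (α : ℂ) ^ 2 * ((t : ℂ) ^ 2 + s * Complex.I) := by
      rw [hz2, ht]; push_cast; field_simp
    have e : ((Real.pi * α : ℝ) : ℂ) / z *
        (2 * z / ((((k : ℂ) + 1 / 2) * Real.pi) ^ 2 + z ^ 2)) =
        ((2 * (Real.pi / α) / (t ^ 4 + s ^ 2) : ℝ) : ℂ) *
          (((t ^ 2 : ℝ) : ℂ) + ((-s : ℝ) : ℂ) * Complex.I) := by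
      rw [hT]
      push_cast
      rw [← hfac]
      have hne2 : (t : ℂ) ^ 2 - s * Complex.I ≠ 0 := right_ne_zero_of_mul (hfac ▸ hden')
      field_simp
      ring
    rw [e, im_ofReal_mul_add]
    ring
  rw [← hval]
  exact h.neg.congr_fun hterm

/-- The summand of `a_N(s) cos s + b_N(s) sin s` at the node `(k + 1/2)π/α`. -/
def midpointTerm (α s : ℝ) (k : ℕ) : ℝ :=
  Real.exp (-(((k : ℝ) + 1 / 2) * Real.pi / α) ^ 2) *
      ((((k : ℝ) + 1 / 2) * Real.pi / α) ^ 2 * Real.sin s + s * Real.cos s) /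
    (((((k : ℝ) + 1 / 2) * Real.pi / α) ^ 2) ^ 2 + s ^ 2)

lemma integral_exp_mul_sin {τ s : ℝ} (hτ : 0 < τ) :
    ∫ v in (0 : ℝ)..1, Real.exp (-(v * τ)) * Real.sin (s * v) =
      s / (τ ^ 2 + s ^ 2) -
        Real.exp (-τ) * (τ * Real.sin s + s * Real.cos s) / (τ ^ 2 + s ^ 2) := by
  have hd : ∀ v ∈ Set.uIcc (0 : ℝ) 1, HasDerivAt
      (fun v => -(Real.exp (-(v * τ)) * (τ * Real.sin (s * v) + s * Real.cos (s * v))) /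
        (τ ^ 2 + s ^ 2)) (Real.exp (-(v * τ)) * Real.sin (s * v)) v := by
    intro v _
    have h1 : HasDerivAt (fun v => Real.exp (-(v * τ))) (Real.exp (-(v * τ)) * -(1 * τ)) v :=
      (((hasDerivAt_id v).mul_const τ).neg).exp
    have h2 : HasDerivAt (fun v => s * v) (s * 1) v := (hasDerivAt_id v).const_mul s
    have h3 := ((h1.mul ((h2.sin.const_mul τ).add (h2.cos.const_mul s))).neg).div_const
      (τ ^ 2 + s ^ 2)
    refine h3.congr_deriv ?_
    have : τ ^ 2 + s ^ 2 ≠ 0 := by positivity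
    simp only [Pi.add_apply]
    field_simp
    ring
  rw [intervalIntegral.integral_eq_sub_of_hasDerivAt hd
    (Continuous.intervalIntegrable (by fun_prop) _ _)]
  simp
  ring

lemma sin_mul_sqrt_intervalIntegrable (s : ℝ) :
    IntervalIntegrable (fun v : ℝ => Real.sin (s * v) * Real.sqrt (Real.pi / v))
      MeasureTheory.volume 0 1 := by
  have h : IntervalIntegrable (fun v : ℝ => v ^ (-(1 / 2) : ℝ)) MeasureTheory.volume 0 1 :=
    intervalIntegral.intervalIntegrable_rpow' (by norm_num)
  have h2 := (h.continuousOn_mul (g := fun v => Real.sin (s * v) * Real.sqrt Real.pi)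
    (by fun_prop))
  refine h2.congr ?_
  intro v hv
  rw [Set.uIoc_of_le zero_le_one] at hv
  simp only
  rw [Real.rpow_neg hv.1.le, ← Real.sqrt_eq_rpow, Real.sqrt_div Real.pi_pos.le]
  ring

lemma integral_sin_mul_sqrt {x : ℝ} (hx : x ≠ 0) :
    ∫ v in (0 : ℝ)..1, Real.sin (Real.pi / 2 * x ^ 2 * v) * Real.sqrt (Real.pi / v) =
      2 * Real.sqrt Real.pi / x * S x := by
  have hcont : Continuous fun t : ℝ => Real.sin (Real.pi * t ^ 2 / 2) := by fun_prop
  have hS : ∀ y, HasDerivAt S (Real.sin (Real.pi * y ^ 2 / 2)) y := fun y =>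
    intervalIntegral.integral_hasDerivAt_right (hcont.intervalIntegrable _ _)
      (hcont.stronglyMeasurableAtFilter _ _) hcont.continuousAt
  have hSc : Continuous S := continuous_iff_continuousAt.2 fun y => (hS y).continuousAt
  have hF := intervalIntegral.integral_eq_sub_of_hasDerivAt_of_le
    (f := fun v => 2 * Real.sqrt Real.pi / x * S (x * Real.sqrt v)) zero_le_one
    (by fun_prop) (fun v hv => ?_) (sin_mul_sqrt_intervalIntegrable (Real.pi / 2 * x ^ 2))
  · rw [hF]; simp [S]
  · have hv0 : 0 < v := hv.1
    have h1 : HasDerivAt (fun v => x * Real.sqrt v) (x * (1 / (2 * Real.sqrt v))) v :=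
      (Real.hasDerivAt_sqrt hv0.ne').const_mul x
    have h2 := ((hS (x * Real.sqrt v)).comp v h1).const_mul (2 * Real.sqrt Real.pi / x)
    refine h2.congr_deriv ?_
    rw [mul_pow, Real.sq_sqrt hv0.le, Real.sqrt_div Real.pi_pos.le]
    have : Real.sqrt v ≠ 0 := (Real.sqrt_pos.2 hv0).ne'
    rw [show Real.pi * (x ^ 2 * v) / 2 = Real.pi / 2 * x ^ 2 * v by ring]
    field_simp

lemma summable_inv_midpoint_sq {α : ℝ} (hα : 0 < α) :
    Summable fun k : ℕ => 1 / (((k : ℝ) + 1 / 2) * Real.pi / α) ^ 2 := by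
  have h := ((summable_nat_add_iff 1).2
    (Real.summable_one_div_nat_pow.2 one_lt_two)).mul_left (4 * (α / Real.pi) ^ 2)
  refine Summable.of_nonneg_of_le (fun k => by positivity) (fun k => ?_) h
  have e : 1 / (((k : ℝ) + 1 / 2) * Real.pi / α) ^ 2 =
      (α / Real.pi) ^ 2 * (1 / ((k : ℝ) + 1 / 2) ^ 2) := by
    field_simp
  rw [e, mul_comm 4, mul_assoc]
  gcongr
  push_cast
  rw [mul_one_div, div_le_div_iff₀ (by positivity) (by positivity)]
  have : (0 : ℝ) ≤ k := k.cast_nonneg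
  nlinarith

lemma integral_norm_exp_mul_sin_le {τ s : ℝ} (hτ : 0 < τ) :
    ∫ v in Set.Ioc (0 : ℝ) 1, ‖Real.exp (-(v * τ)) * Real.sin (s * v)‖ ≤ 1 / τ := by
  have hd : ∀ v ∈ Set.uIcc (0 : ℝ) 1, HasDerivAt (fun v => -Real.exp (-(v * τ)) / τ)
      (Real.exp (-(v * τ))) v := by
    intro v _
    refine ((((hasDerivAt_id v).mul_const τ).neg).exp.neg.div_const τ).congr_deriv ?_
    field_simp
    simp [mul_comm]
  rw [← intervalIntegral.integral_of_le zero_le_one]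
  calc ∫ v in (0 : ℝ)..1, ‖Real.exp (-(v * τ)) * Real.sin (s * v)‖
      ≤ ∫ v in (0 : ℝ)..1, Real.exp (-(v * τ)) := by
        refine intervalIntegral.integral_mono_on zero_le_one
          (Continuous.intervalIntegrable (by fun_prop) _ _)
          (Continuous.intervalIntegrable (by fun_prop) _ _) fun v _ => ?_
        rw [norm_mul, Real.norm_of_nonneg (Real.exp_pos _).le]
        exact mul_le_of_le_one_right (Real.exp_pos _).le (Real.abs_sin_le_one _)
    _ = 1 / τ - Real.exp (-τ) / τ := by
        rw [intervalIntegral.integral_eq_sub_of_hasDerivAt hd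
          (Continuous.intervalIntegrable (by fun_prop) _ _)]
        simp
        ring
    _ ≤ 1 / τ := by
        have : 0 ≤ Real.exp (-τ) / τ := by positivity
        linarith

lemma hasSum_integral_exp_mul_sin {α : ℝ} (hα : 0 < α) (s : ℝ) :
    HasSum (fun k : ℕ => ∫ v in (0 : ℝ)..1,
        Real.exp (-(v * (((k : ℝ) + 1 / 2) * Real.pi / α) ^ 2)) * Real.sin (s * v))
      (∫ v in (0 : ℝ)..1, Real.sin (s * v) *
        ∑' k : ℕ, Real.exp (-(v * (((k : ℝ) + 1 / 2) * Real.pi / α) ^ 2))) := by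
  simp only [intervalIntegral.integral_of_le (zero_le_one (α := ℝ))]
  have h := MeasureTheory.hasSum_integral_of_summable_integral_norm
    (μ := MeasureTheory.volume.restrict (Set.Ioc (0 : ℝ) 1))
    (F := fun (k : ℕ) v =>
      Real.exp (-(v * (((k : ℝ) + 1 / 2) * Real.pi / α) ^ 2)) * Real.sin (s * v))
    (fun k => (Continuous.intervalIntegrable (by fun_prop) 0 1).1)
    (Summable.of_nonneg_of_le (fun k => MeasureTheory.integral_nonneg fun _ => norm_nonneg _)
      (fun k => integral_norm_exp_mul_sin_le (by positivity)) (summable_inv_midpoint_sq hα))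
  simpa only [tsum_mul_right, mul_comm (Real.sin _)] using h

lemma abs_tsum_exp_sub_le {α v : ℝ} (hα : 2 ≤ α ^ 2) (hα0 : 0 < α) (hv : 0 < v) (hv1 : v ≤ 1) :
    |2 * (Real.pi / α) * ∑' k : ℕ, Real.exp (-(v * (((k : ℝ) + 1 / 2) * Real.pi / α) ^ 2)) -
      Real.sqrt (Real.pi / v)| ≤ 3 * Real.sqrt (Real.pi / v) * Real.exp (-(α ^ 2 / v)) := by
  set a := α ^ 2 / (Real.pi * v) with ha
  have ha0 : 0 < a := by positivity
  have e1 : -Real.pi * a = -(α ^ 2 / v) := by rw [ha]; field_simp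
  have hq : Real.exp (-Real.pi * a) ≤ 1 / 3 := by
    rw [e1, Real.exp_neg, ← one_div]
    apply one_div_le_one_div_of_le (by norm_num)
    have : 2 ≤ α ^ 2 / v := by rw [le_div_iff₀ hv]; linarith
    linarith [Real.add_one_le_exp (α ^ 2 / v)]
  have h := abs_tsum_gaussian_midpoint_sub_le ha0 hq
  rw [e1] at h
  have e2 : ∀ k : ℕ, -(Real.pi / a) * ((k : ℝ) + 1 / 2) ^ 2 =
      -(v * (((k : ℝ) + 1 / 2) * Real.pi / α) ^ 2) := by
    intro k; rw [ha]; field_simp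
  simp only [e2, tsum_mul_left] at h
  have e3 : Real.pi / α * Real.sqrt a = Real.sqrt (Real.pi / v) := by
    rw [← Real.sqrt_sq (show 0 ≤ Real.pi / α by positivity), ← Real.sqrt_mul (by positivity)]
    congr 1
    rw [ha]; field_simp
  have h2 := mul_le_mul_of_nonneg_left h (show 0 ≤ Real.pi / α by positivity)
  rw [← abs_of_nonneg (show 0 ≤ Real.pi / α by positivity), ← abs_mul,
    abs_of_nonneg (show 0 ≤ Real.pi / α by positivity)] at h2
  rw [← e3]
  convert! h2 using 1
  · congr 1; ring
  · ring

lemma abs_integral_sin_mul_tsum_sub_le {α s : ℝ} (hα : 2 ≤ α ^ 2) (hα0 : 0 < α) (hs : 0 < s) :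
    |2 * (Real.pi / α) * (∫ v in (0 : ℝ)..1, Real.sin (s * v) *
        ∑' k : ℕ, Real.exp (-(v * (((k : ℝ) + 1 / 2) * Real.pi / α) ^ 2))) -
      ∫ v in (0 : ℝ)..1, Real.sin (s * v) * Real.sqrt (Real.pi / v)| ≤
      3 * Real.sqrt Real.pi * s * Real.exp (-α ^ 2) / α ^ 2 := by
  have hpi := Real.pi_pos
  set Θ : ℝ → ℝ := fun v => ∑' k : ℕ, Real.exp (-(v * (((k : ℝ) + 1 / 2) * Real.pi / α) ^ 2))
    with hΘ
  set G : ℝ → ℝ := fun v => 3 * Real.sqrt Real.pi * s * Real.exp (-α ^ 2) *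
    Real.exp (-(α ^ 2 * (1 - v))) with hG
  have hGc : Continuous G := by fun_prop
  have hbound : ∀ v ∈ Set.Ioc (0 : ℝ) 1,
      ‖2 * (Real.pi / α) * (Real.sin (s * v) * Θ v) - Real.sin (s * v) * Real.sqrt (Real.pi / v)‖
        ≤ G v := by
    intro v hv
    have h1 := abs_tsum_exp_sub_le hα hα0 hv.1 hv.2
    have h2 : |Real.sin (s * v)| ≤ s * v := by
      have := Real.abs_sin_le_abs (x := s * v)
      rwa [abs_of_pos (mul_pos hs hv.1)] at this
    have h3 : Real.exp (-(α ^ 2 / v)) ≤ Real.exp (-α ^ 2) * Real.exp (-(α ^ 2 * (1 - v))) := by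
      rw [← Real.exp_add]
      apply Real.exp_le_exp.2
      have : 2 - v ≤ 1 / v := by
        rw [le_div_iff₀ hv.1]; nlinarith [sq_nonneg (v - 1)]
      have h4 : α ^ 2 * (2 - v) ≤ α ^ 2 * (1 / v) := by gcongr
      rw [mul_one_div] at h4
      linarith
    have h5 : v * Real.sqrt (Real.pi / v) ≤ Real.sqrt Real.pi := by
      rw [Real.sqrt_div hpi.le]
      have h6 : Real.sqrt v * Real.sqrt v = v := Real.mul_self_sqrt hv.1.le
      have h8 : Real.sqrt v ≤ 1 := Real.sqrt_le_one.2 hv.2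
      calc v * (Real.sqrt Real.pi / Real.sqrt v) = Real.sqrt v * Real.sqrt Real.pi := by
            nth_rewrite 1 [← h6]; field_simp
        _ ≤ _ := mul_le_of_le_one_left (Real.sqrt_nonneg _) h8
    calc ‖2 * (Real.pi / α) * (Real.sin (s * v) * Θ v) -
          Real.sin (s * v) * Real.sqrt (Real.pi / v)‖
        = |Real.sin (s * v)| * |2 * (Real.pi / α) * Θ v - Real.sqrt (Real.pi / v)| := by
          rw [← abs_mul, Real.norm_eq_abs]; congr 1; ring
      _ ≤ (s * v) * (3 * Real.sqrt (Real.pi / v) * Real.exp (-(α ^ 2 / v))) := by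
          have := mul_pos hs hv.1
          gcongr
      _ = 3 * s * (v * Real.sqrt (Real.pi / v)) * Real.exp (-(α ^ 2 / v)) := by ring
      _ ≤ 3 * s * Real.sqrt Real.pi *
          (Real.exp (-α ^ 2) * Real.exp (-(α ^ 2 * (1 - v)))) := by gcongr
      _ = G v := by rw [hG]; ring
  have hae : ∀ᵐ v ∂(MeasureTheory.volume.restrict (Set.Ioc (0 : ℝ) 1)),
      ‖2 * (Real.pi / α) * (Real.sin (s * v) * Θ v) - Real.sin (s * v) * Real.sqrt (Real.pi / v)‖
        ≤ G v :=
    (MeasureTheory.ae_restrict_iff' measurableSet_Ioc).2 (Filter.Eventually.of_forall hbound)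
  have hint0 := sin_mul_sqrt_intervalIntegrable s
  have hdiff : IntervalIntegrable (fun v => 2 * (Real.pi / α) * (Real.sin (s * v) * Θ v) -
      Real.sin (s * v) * Real.sqrt (Real.pi / v)) MeasureTheory.volume 0 1 := by
    rw [intervalIntegrable_iff_integrableOn_Ioc_of_le zero_le_one]
    refine MeasureTheory.Integrable.mono' (hGc.intervalIntegrable 0 1).1 ?_ hae
    exact Measurable.aestronglyMeasurable (by fun_prop)
  have hint1 : IntervalIntegrable (fun v => 2 * (Real.pi / α) * (Real.sin (s * v) * Θ v))
      MeasureTheory.volume 0 1 := by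
    simpa using hdiff.add hint0
  rw [← intervalIntegral.integral_const_mul, ← intervalIntegral.integral_sub hint1 hint0,
    ← Real.norm_eq_abs]
  have hd : ∀ v ∈ Set.uIcc (0 : ℝ) 1, HasDerivAt (fun v => 3 * Real.sqrt Real.pi * s *
      Real.exp (-α ^ 2) * (Real.exp (-(α ^ 2 * (1 - v))) / α ^ 2)) (G v) v := by
    intro v _
    refine ((((((hasDerivAt_id v).const_sub 1).const_mul (α ^ 2)).neg).exp.div_const
      (α ^ 2)).const_mul _).congr_deriv ?_
    rw [hG]
    field_simp
    simp
  calc _ ≤ ∫ v in (0 : ℝ)..1, G v :=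
        intervalIntegral.norm_integral_le_of_norm_le zero_le_one
          (Filter.Eventually.of_forall hbound) (hGc.intervalIntegrable 0 1)
    _ = 3 * Real.sqrt Real.pi * s * Real.exp (-α ^ 2) * (1 / α ^ 2) -
        3 * Real.sqrt Real.pi * s * Real.exp (-α ^ 2) * (Real.exp (-α ^ 2) / α ^ 2) := by
        rw [intervalIntegral.integral_eq_sub_of_hasDerivAt hd (hGc.intervalIntegrable 0 1)]
        simp
    _ ≤ _ := by
        have : 0 ≤ 3 * Real.sqrt Real.pi * s * Real.exp (-α ^ 2) *
          (Real.exp (-α ^ 2) / α ^ 2) := by positivity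
        rw [mul_one_div]
        linarith

lemma abs_midpoint_tail_le {N : ℕ} {α s : ℝ} (hα0 : 0 < α) (hs : 0 < s) (hα1 : 1 ≤ α ^ 2)
    (hα : α ^ 2 = ((N : ℝ) + 1 / 2) * Real.pi) :
    |∑' j : ℕ, 2 * (Real.pi / α) * midpointTerm α s (j + N)| ≤
      8 * Real.pi * s * Real.exp (-α ^ 2) / α ^ 3 := by
  have hpi := Real.pi_pos
  have hsum : HasSum (fun j : ℕ => 2 * (Real.pi / α) * (s * (2 / α ^ 2) * Real.exp (-α ^ 2)) *
      (1 / 2 : ℝ) ^ j) (2 * (Real.pi / α) * (s * (2 / α ^ 2) * Real.exp (-α ^ 2)) * 2) :=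
    hasSum_geometric_two.mul_left _
  have hb : ∀ j : ℕ, ‖2 * (Real.pi / α) * midpointTerm α s (j + N)‖ ≤
      2 * (Real.pi / α) * (s * (2 / α ^ 2) * Real.exp (-α ^ 2)) * (1 / 2 : ℝ) ^ j := by
    intro j
    have hj : (0 : ℝ) ≤ j := j.cast_nonneg
    have hnode : (((j + N : ℕ) : ℝ) + 1 / 2) * Real.pi / α = α + j * Real.pi / α := by
      field_simp
      push_cast
      linear_combination -2 * hα
    rw [midpointTerm, hnode]
    set τ := (α + j * Real.pi / α) ^ 2 with hτ
    have hτ2 : α ^ 2 + 2 * Real.pi * j ≤ τ := by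
      have : τ = α ^ 2 + 2 * Real.pi * j + (j * Real.pi / α) ^ 2 := by
        rw [hτ]; field_simp; ring
      rw [this]
      linarith [sq_nonneg (j * Real.pi / α)]
    have hτα : α ^ 2 ≤ τ := by nlinarith [mul_nonneg hpi.le hj]
    have hτ0 : 0 < τ := by linarith
    have hexp : Real.exp (-τ) ≤ Real.exp (-α ^ 2) * (1 / 2 : ℝ) ^ j := by
      have h1 : Real.exp (-1) ≤ 1 / 2 := by
        rw [Real.exp_neg, ← one_div]
        exact one_div_le_one_div_of_le two_pos (by linarith [Real.add_one_le_exp (1 : ℝ)])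
      calc Real.exp (-τ) ≤ Real.exp (-α ^ 2 + j * (-1)) := by
            apply Real.exp_le_exp.2
            nlinarith [Real.pi_gt_three]
        _ = Real.exp (-α ^ 2) * Real.exp (-1) ^ j := by rw [Real.exp_add, Real.exp_nat_mul]
        _ ≤ _ := by gcongr
    have htrig : |τ * Real.sin s + s * Real.cos s| ≤ s * (τ + 1) := by
      have h1 : |Real.sin s| ≤ s := by
        simpa only [abs_of_pos hs] using Real.abs_sin_le_abs (x := s)
      calc |τ * Real.sin s + s * Real.cos s| ≤ |τ * Real.sin s| + |s * Real.cos s| :=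
            abs_add_le _ _
        _ = τ * |Real.sin s| + s * |Real.cos s| := by
            rw [abs_mul, abs_mul, abs_of_pos hτ0, abs_of_pos hs]
        _ ≤ τ * s + s * 1 := by
            gcongr
            exact Real.abs_cos_le_one s
        _ = _ := by ring
    have hfrac : s * (τ + 1) / (τ ^ 2 + s ^ 2) ≤ s * (2 / α ^ 2) := by
      rw [mul_div_assoc]
      refine mul_le_mul_of_nonneg_left ?_ hs.le
      rw [div_le_div_iff₀ (by positivity) (by positivity)]
      nlinarith [sq_nonneg s]
    rw [norm_mul, Real.norm_of_nonneg (show 0 ≤ 2 * (Real.pi / α) by positivity),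
      mul_assoc (2 * (Real.pi / α))]
    refine mul_le_mul_of_nonneg_left ?_ (by positivity)
    rw [Real.norm_eq_abs, abs_div, abs_mul, abs_of_pos (Real.exp_pos _),
      abs_of_pos (show 0 < τ ^ 2 + s ^ 2 by positivity)]
    calc Real.exp (-τ) * |τ * Real.sin s + s * Real.cos s| / (τ ^ 2 + s ^ 2)
        ≤ Real.exp (-τ) * (s * (τ + 1)) / (τ ^ 2 + s ^ 2) := by gcongr
      _ = Real.exp (-τ) * (s * (τ + 1) / (τ ^ 2 + s ^ 2)) := by ring
      _ ≤ (Real.exp (-α ^ 2) * (1 / 2 : ℝ) ^ j) * (s * (2 / α ^ 2)) := by gcongr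
      _ = _ := by ring
  refine (tsum_of_norm_bounded hsum hb).trans (le_of_eq ?_)
  field_simp
  norm_num

lemma fresnel_correction_sum_eq (N : ℕ) (s : ℝ) :
    aN N s * Real.cos s + bN N s * Real.sin s =
      ∑ k ∈ Finset.range N, midpointTerm (A N) s k := by
  have hnode : ∀ k : ℕ, tk N (k + 1) = ((k : ℝ) + 1 / 2) * Real.pi / A N := fun k => by
    rw [tk, A]
    push_cast
    ring_nf
  rw [aN, bN, Finset.mul_sum, Finset.sum_mul, Finset.sum_mul, ← Finset.sum_add_distrib,
    ← Finset.Ico_succ_right_eq_Icc, Finset.sum_Ico_eq_sum_range]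
  refine Finset.sum_congr (by simp) fun k _ => ?_
  rw [add_comm 1 k, hnode, midpointTerm]
  ring

lemma S_sub_SN_eq {N : ℕ} {x : ℝ} (hx : x ≠ 0) :
    S x - SN N x = x / (2 * Real.sqrt Real.pi) *
      ((∫ v in (0 : ℝ)..1, Real.sin (Real.pi / 2 * x ^ 2 * v) * Real.sqrt (Real.pi / v)) -
        2 * (Real.pi / A N) * (∫ v in (0 : ℝ)..1, Real.sin (Real.pi / 2 * x ^ 2 * v) *
          ∑' k : ℕ, Real.exp (-(v * (((k : ℝ) + 1 / 2) * Real.pi / A N) ^ 2))) -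
        ∑' j : ℕ, 2 * (Real.pi / A N) * midpointTerm (A N) (Real.pi / 2 * x ^ 2) (j + N)) := by
  have hpi := Real.pi_pos
  have hα : 0 < A N := Real.sqrt_pos.2 (by positivity)
  have hsq : Real.sqrt Real.pi ^ 2 = Real.pi := Real.sq_sqrt hpi.le
  have h1 := hasSum_fresnel_correction hα hx
  have h2 := (hasSum_integral_exp_mul_sin hα (Real.pi / 2 * x ^ 2)).mul_left (2 * (Real.pi / A N))
  have h3 : HasSum (fun k : ℕ => 2 * (Real.pi / A N) *
      midpointTerm (A N) (Real.pi / 2 * x ^ 2) k) _ := (h1.sub h2).congr_fun fun k => by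
    rw [integral_exp_mul_sin (by positivity), midpointTerm]
    ring
  have h4 := h3.summable.sum_add_tsum_nat_add N
  rw [h3.tsum_eq, ← Finset.mul_sum, ← fresnel_correction_sum_eq] at h4
  rw [integral_sin_mul_sqrt hx, eq_sub_of_add_eq' h4, SN]
  set G := aN N (Real.pi / 2 * x ^ 2) * Real.cos (Real.pi / 2 * x ^ 2) +
    bN N (Real.pi / 2 * x ^ 2) * Real.sin (Real.pi / 2 * x ^ 2)
  generalize (∫ v in (0 : ℝ)..1, Real.sin (Real.pi / 2 * x ^ 2 * v) *
          ∑' k : ℕ, Real.exp (-(v * (((k : ℝ) + 1 / 2) * Real.pi / A N) ^ 2))) = J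
  generalize (Real.sinh (Real.sqrt Real.pi * A N * x) - Real.sin (Real.sqrt Real.pi * A N * x)) /
          (Real.cos (Real.sqrt Real.pi * A N * x) + Real.cosh (Real.sqrt Real.pi * A N * x)) = Q
  field_simp
  linear_combination 2 * x * G * hsq

lemma le_chat (N : ℕ) : 20 * Real.sqrt 2 * Real.exp (-Real.pi / 2) / (9 * Real.pi) ≤ chat N := by
  have hA : 0 < A N := Real.sqrt_pos.2 (by positivity)
  have hlt : Real.exp (-2 * A N ^ 2) < 1 := Real.exp_lt_one_iff.2 (by nlinarith [pow_pos hA 2])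
  have hpos := Real.exp_pos (-2 * A N ^ 2)
  have h1 : 20 * Real.sqrt 2 * Real.exp (-Real.pi / 2) / (9 * Real.pi) ≤
      20 * Real.sqrt 2 * Real.exp (-Real.pi / 2) /
        (9 * Real.pi * (1 - Real.exp (-2 * A N ^ 2))) := by
    exact div_le_div_of_nonneg_left (by positivity) (by positivity)
      (mul_le_of_le_one_right (by positivity) (by linarith))
  have h2 : 20 * Real.sqrt 2 * Real.exp (-Real.pi / 2) /
        (9 * Real.pi * (1 - Real.exp (-2 * A N ^ 2))) ≤
      20 * Real.sqrt 2 * Real.exp (-Real.pi / 2) /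
        (9 * Real.pi * (1 - Real.exp (-2 * A N ^ 2))) *
      (1 + 2 * Real.sqrt Real.pi * Real.exp (-β * A N ^ 2)) :=
    le_mul_of_one_le_right (by positivity) (le_add_of_nonneg_right (by positivity))
  have h3 : 0 ≤ (2 * Real.pi + 1) * Real.exp (-Real.pi / 2) /
      (2 * Real.sqrt 2 * (Real.pi * Real.sqrt Real.pi) * A N) := by positivity
  have h4 : 0 ≤ Real.sqrt 2 * (2 * Real.pi + 1) /
    ((Real.pi * Real.sqrt Real.pi) * Real.exp (Real.pi / 2) * Real.sqrt ((N : ℝ) + 1 / 2)) := by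
    positivity
  rw [chat, c]
  linarith

lemma seven_eighths_mul_exp_le (N : ℕ) :
    7 / 8 * Real.exp (-A N ^ 2) ≤
      Real.sqrt 2 * chat N * Real.exp (-Real.pi * ((N : ℝ) - 1 / 4)) := by
  have hA : A N ^ 2 = ((N : ℝ) + 1 / 2) * Real.pi := Real.sq_sqrt (by positivity)
  have h2 : Real.sqrt 2 * Real.sqrt 2 = 2 := Real.mul_self_sqrt two_pos.le
  have e : Real.exp (-Real.pi * ((N : ℝ) - 1 / 4)) * Real.exp (-Real.pi / 2) =
      Real.exp (-A N ^ 2) * Real.exp (Real.pi / 4) := by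
    rw [← Real.exp_add, ← Real.exp_add, hA]; congr 1; ring
  have h1 : 1 ≤ Real.exp (Real.pi / 4) := Real.one_le_exp (by positivity)
  calc 7 / 8 * Real.exp (-A N ^ 2) ≤ 40 / (9 * Real.pi) * (Real.exp (-A N ^ 2) * 1) := by
        rw [mul_one]
        refine mul_le_mul_of_nonneg_right ?_ (Real.exp_pos _).le
        rw [div_le_div_iff₀ (by norm_num) (by positivity)]
        linarith [Real.pi_lt_four]
    _ ≤ 40 / (9 * Real.pi) * (Real.exp (-A N ^ 2) * Real.exp (Real.pi / 4)) := by gcongr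
    _ = Real.sqrt 2 * (20 * Real.sqrt 2 * Real.exp (-Real.pi / 2) / (9 * Real.pi)) *
          Real.exp (-Real.pi * ((N : ℝ) - 1 / 4)) := by
        rw [← e]
        field_simp
        linear_combination (-20 : ℝ) * h2
    _ ≤ _ := by
        gcongr
        exact le_chat N

theorem stmt_16 (N : ℕ) (hN : 4 ≤ N) (x : ℝ) (hx : |x| < 1) :
    |S x - SN N x| ≤
      |x| ^ 3 / (1 - |x| ^ 4) * (Real.sqrt 2 * chat N *
        Real.exp (-Real.pi * ((N : ℝ) - 1 / 4)) / Real.sqrt ((N : ℝ) + 1 / 2)) := by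
  have hpi := Real.pi_pos
  set α := A N with hαdef
  have hN' : (4 : ℝ) ≤ N := by exact_mod_cast hN
  have hα2 : α ^ 2 = ((N : ℝ) + 1 / 2) * Real.pi := Real.sq_sqrt (by positivity)
  have hα : 0 < α := Real.sqrt_pos.2 (by positivity)
  rcases eq_or_ne x 0 with rfl | hx0
  · simp [S, SN]
  have hsq : Real.sqrt Real.pi ^ 2 = Real.pi := Real.sq_sqrt hpi.le
  have hs : 0 < Real.pi / 2 * x ^ 2 := by positivity
  have hα2' : 2 ≤ α ^ 2 := by rw [hα2]; nlinarith [Real.pi_gt_three]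
  have hαπ : 2 * Real.sqrt Real.pi ≤ α := by
    refine abs_le_of_sq_le_sq' ?_ hα.le |>.2
    rw [mul_pow, hsq, hα2]
    nlinarith
  have hx0' : 0 < |x| := abs_pos.2 hx0
  have hx4 : 0 < 1 - |x| ^ 4 := by
    have := pow_lt_one₀ hx0'.le hx (n := 4) (by norm_num)
    linarith
  set r := Real.sqrt ((N : ℝ) + 1 / 2) with hr
  have hr2 : r ^ 2 = (N : ℝ) + 1 / 2 := Real.sq_sqrt (by positivity)
  have hr' : 2 ≤ r := Real.le_sqrt_of_sq_le (by linarith)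
  have hr0 : 0 < r := by linarith
  have hmain := abs_integral_sin_mul_tsum_sub_le hα2' hα hs
  have htail := abs_midpoint_tail_le (N := N) hα hs (by linarith) hα2
  have hfac : |x / (2 * Real.sqrt Real.pi)| = |x| / (2 * Real.sqrt Real.pi) := by
    rw [abs_div, abs_of_pos (show 0 < 2 * Real.sqrt Real.pi by positivity)]
  have hE : 0 < Real.exp (-α ^ 2) := Real.exp_pos _
  have hfinal := seven_eighths_mul_exp_le N
  rw [← hαdef] at hfinal
  calc |S x - SN N x| ≤ |x| / (2 * Real.sqrt Real.pi) *
        (3 * Real.sqrt Real.pi * (Real.pi / 2 * x ^ 2) * Real.exp (-α ^ 2) / α ^ 2 +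
          8 * Real.pi * (Real.pi / 2 * x ^ 2) * Real.exp (-α ^ 2) / α ^ 3) := by
        rw [S_sub_SN_eq hx0, abs_mul, hfac]
        gcongr
        refine (abs_sub _ _).trans (add_le_add ?_ htail)
        rw [abs_sub_comm]
        exact hmain
    _ = |x| ^ 3 * (Real.exp (-α ^ 2) * ((3 / 4 * Real.pi + 2 * Real.pi * Real.sqrt Real.pi / α) /
          α ^ 2)) := by
        rw [← sq_abs x]
        field_simp
        linear_combination (-32 : ℝ) * hsq
    _ ≤ |x| ^ 3 * (Real.exp (-α ^ 2) * (7 / 8 / r)) := by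
        refine mul_le_mul_of_nonneg_left (mul_le_mul_of_nonneg_left ?_ hE.le) (by positivity)
        have h1 : 2 * Real.pi * Real.sqrt Real.pi / α ≤ Real.pi := by
          rw [div_le_iff₀ hα]; nlinarith
        rw [div_le_div_iff₀ (by positivity) hr0, hα2, ← hr2]
        nlinarith [mul_nonneg (mul_pos hr0 hpi).le (sub_nonneg.2 hr')]
    _ = |x| ^ 3 * ((7 / 8 * Real.exp (-α ^ 2)) / r) := by ring
    _ ≤ |x| ^ 3 * (Real.sqrt 2 * chat N * Real.exp (-Real.pi * ((N : ℝ) - 1 / 4)) / r) := by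
        gcongr
    _ ≤ _ := by
        have hpos : 0 ≤ Real.sqrt 2 * chat N * Real.exp (-Real.pi * ((N : ℝ) - 1 / 4)) / r :=
          div_nonneg (le_trans (by positivity) hfinal) hr0.le
        gcongr
        rw [le_div_iff₀ hx4]
        exact mul_le_of_le_one_right (by positivity) (by linarith [pow_pos hx0' 4])

end
end
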